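/- arXiv:math/0110146 — 2 statements merged into one kernel-verified Lean document; each statement's English description precedes it below -/
import Mathlib

section
/- There exist reflexive Banach spaces X and Y such that: Y has a basis which arises as a spreading model of a normalized basic sequence in X; the unit vector basis of ℓ₁ is equivalent to a spreading model of some normalized basic sequence in Y; and no asymptotic model of X is equivalent to the unit vector basis of ℓ₁. -/
open Filter Finset Topology

variable {X : Type*} [NormedAddCommGroup X] [NormedSpace ℝ X]
variable {E : Type*} [NormedAddCommGroup E] [NormedSpace ℝ E]

/-- `(x i)` is a `C`-basic sequence. -/
def IsCBasic (C : ℝ) (x : ℕ → X) : Prop :=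
  (∀ i, x i ≠ 0) ∧
    ∀ n m : ℕ, n < m → ∀ a : ℕ → ℝ,
      ‖∑ i ∈ Finset.range n, a i • x i‖ ≤ C * ‖∑ i ∈ Finset.range m, a i • x i‖

/-- The finite sequence `y 0, …, y (m-1)` is `C`-basic. -/
def IsCBasicUpTo (C : ℝ) (m : ℕ) (y : ℕ → X) : Prop :=
  (∀ j, j < m → y j ≠ 0) ∧
    ∀ n k : ℕ, n < k → k ≤ m → ∀ a : ℕ → ℝ,
      ‖∑ i ∈ Finset.range n, a i • y i‖ ≤ C * ‖∑ i ∈ Finset.range k, a i • y i‖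

/-- `(x i)` is normalized. -/
def Normalized (x : ℕ → X) : Prop := ∀ i, ‖x i‖ = 1

/-- `x` is a `K`-basic array: each row `x n` is a normalized `K`-basic sequence and every
"diagonal" sequence `(x j (i j))_{j<m}` with `m ≤ i 0 < i 1 < ⋯` is `K`-basic. -/
def IsBasicArrayWith (K : ℝ) (x : ℕ → ℕ → X) : Prop :=
  (∀ n, Normalized (x n) ∧ IsCBasic K (x n)) ∧
    ∀ (m : ℕ) (i : ℕ → ℕ), StrictMono i → m ≤ i 0 →
      IsCBasicUpTo K m fun j => x j (i j)

/-- `x` is a basic array if it is a `K`-basic array for some `K`. -/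
def IsBasicArray (x : ℕ → ℕ → X) : Prop := ∃ K : ℝ, IsBasicArrayWith K x

/-- `IteratedLimit n f L`: the iterated limit `lim_{i₀→∞} ⋯ lim_{i_{n-1}→∞} f (i₀, …, i_{n-1})`
exists and equals `L`. -/
def IteratedLimit : ∀ n : ℕ, ((Fin n → ℕ) → ℝ) → ℝ → Prop
  | 0, f, L => f (fun i => i.elim0) = L
  | n + 1, f, L => ∃ g : ℕ → ℝ,
      (∀ i₀ : ℕ, IteratedLimit n (fun t => f (Fin.cons i₀ t)) (g i₀)) ∧
      Filter.Tendsto g Filter.atTop (nhds L)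

/-- The array `y` in `X` generates the asymptotic model `e`: all the iterated limits
`lim_{i₀→∞} ⋯ lim_{i_{n-1}→∞} ‖∑_{j<n} b j • y j (i j)‖` exist and equal
`‖∑_{j<n} b j • e j‖`. -/
def GeneratesAsymptoticModel (y : ℕ → ℕ → X) (e : ℕ → E) : Prop :=
  ∀ (n : ℕ) (b : ℕ → ℝ),
    IteratedLimit n (fun t => ‖∑ j : Fin n, b (j : ℕ) • y (j : ℕ) (t j)‖)
      ‖∑ j ∈ Finset.range n, b j • e j‖

/-- `e` is an asymptotic model of `X`: it is a normalized basic sequence generated by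
some basic array in `X`. -/
def IsAsymptoticModel (X : Type*) [NormedAddCommGroup X] [NormedSpace ℝ X]
    {E : Type*} [NormedAddCommGroup E] [NormedSpace ℝ E] (e : ℕ → E) : Prop :=
  Normalized e ∧ (∃ C : ℝ, IsCBasic C e) ∧
    ∃ y : ℕ → ℕ → X, IsBasicArray y ∧ GeneratesAsymptoticModel y e

/-- A normed space over `ℝ`, bundled. -/
structure NormedSpc where
  carrier : Type
  [grp : NormedAddCommGroup carrier]
  [mod : NormedSpace ℝ carrier]

attribute [instance] NormedSpc.grp NormedSpc.mod

/-- A Banach space over `ℝ`, bundled. -/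
structure BanachSpc where
  carrier : Type
  [grp : NormedAddCommGroup carrier]
  [mod : NormedSpace ℝ carrier]
  [comp : CompleteSpace carrier]

attribute [instance] BanachSpc.grp BanachSpc.mod BanachSpc.comp

/-- A Banach space is reflexive if the canonical inclusion into its double dual is onto. -/
def IsReflexive (Z : Type*) [NormedAddCommGroup Z] [NormedSpace ℝ Z] : Prop :=
  Function.Surjective ⇑(NormedSpace.inclusionInDoubleDual ℝ Z)

/-- `b` is a (Schauder) basis of the space. -/
def IsSchauderBasis (b : ℕ → X) : Prop :=
  (∃ C : ℝ, IsCBasic C b) ∧ Dense (Submodule.span ℝ (Set.range b) : Set X)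

/-- `e` is a spreading model of the sequence `y`. -/
def IsSpreadingModelOf (y : ℕ → X) (e : ℕ → E) : Prop :=
  ∀ (n : ℕ) (b : ℕ → ℝ),
    IteratedLimit n (fun t => ‖∑ j : Fin n, b (j : ℕ) • y (t j)‖)
      ‖∑ j ∈ Finset.range n, b j • e j‖

/-- `e` is equivalent to the unit vector basis of `ℓ₁`. -/
def EquivToL1Basis (e : ℕ → E) : Prop :=
  ∃ A B : ℝ, 0 < A ∧ 0 < B ∧ ∀ (n : ℕ) (c : ℕ → ℝ),
    A⁻¹ * (∑ i ∈ Finset.range n, |c i|) ≤ ‖∑ i ∈ Finset.range n, c i • e i‖ ∧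
      ‖∑ i ∈ Finset.range n, c i • e i‖ ≤ B * ∑ i ∈ Finset.range n, |c i|

/-! ### Combinations of admissible functionals -/

/-- `Comb adm f w S`: on `S`, the weight `f` is a disjoint combination `∑ aᵢ cᵢ` of admissible
weights `cᵢ`, with `aᵢ ≥ 0` and `∑ aᵢ ^ 2 = w`. -/
inductive Comb (adm : Finset ℕ → (ℕ → ℝ) → Prop) (f : ℕ → ℝ) : ℝ → Finset ℕ → Prop
  | empty : Comb adm f 0 ∅
  | base {S : Finset ℕ} {c : ℕ → ℝ} (a : ℝ) (ha : 0 ≤ a) (h : adm S c)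
      (hf : ∀ t ∈ S, f t = a * c t) : Comb adm f (a ^ 2) S
  | union {w w' : ℝ} {S S' : Finset ℕ} (h : Comb adm f w S) (h' : Comb adm f w' S')
      (hd : Disjoint S S') : Comb adm f (w + w') (S ∪ S')

namespace Comb

variable {adm adm' : Finset ℕ → (ℕ → ℝ) → Prop} {f f' : ℕ → ℝ} {w w' : ℝ} {S T : Finset ℕ}

theorem weight_nonneg (h : Comb adm f w S) : 0 ≤ w := by
  induction h with
  | empty => exact le_rfl
  | base a ha h hf => positivity
  | union _ _ _ h1 h2 => positivity

theorem imp (H : ∀ S c, adm S c → adm' S c) (h : Comb adm f w S) : Comb adm' f w S := by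
  induction h with
  | empty => exact empty
  | base a ha h hf => exact base a ha (H _ _ h) hf
  | union _ _ hd h1 h2 => exact union h1 h2 hd

theorem congr (h : Comb adm f w S) (H : ∀ t ∈ S, f' t = f t) : Comb adm f' w S := by
  induction h with
  | empty => exact empty
  | base a ha h hf => exact base a ha h fun t ht => (H t ht).trans (hf t ht)
  | union _ _ hd h1 h2 =>
    exact union (h1 fun t ht => H t (Finset.mem_union_left _ ht))
      (h2 fun t ht => H t (Finset.mem_union_right _ ht)) hd

theorem scale (h : Comb adm f w S) {r : ℝ} (hr : 0 ≤ r) :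
    Comb adm (fun t => r * f t) (r ^ 2 * w) S := by
  induction h with
  | empty => simpa using empty
  | base a ha h hf =>
    have := base (f := fun t => r * f t) (r * a) (by positivity) h
      fun t ht => by rw [hf t ht]; ring
    rwa [mul_pow] at this
  | union _ _ hd h1 h2 => rw [mul_add]; exact union h1 h2 hd

theorem subset (H : ∀ S T c, S ⊆ T → adm T c → adm S c) (h : Comb adm f w S) :
    ∀ T ⊆ S, Comb adm f w T := by
  induction h with
  | empty => intro T hT; rw [Finset.subset_empty.1 hT]; exact empty
  | base a ha h hf => exact fun T hT => base a ha (H _ _ _ hT h) fun t ht => hf t (hT ht)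
  | @union w w' S S' _ _ hd h1 h2 =>
    intro T hT
    have : T = (T ∩ S) ∪ (T ∩ S') := by
      rw [← Finset.inter_union_distrib_left, Finset.inter_eq_left.2 hT]
    rw [this]
    exact union (h1 _ Finset.inter_subset_right) (h2 _ Finset.inter_subset_right)
      (hd.mono Finset.inter_subset_right Finset.inter_subset_right)

theorem sum_sq_le {C : ℝ} (h : Comb adm f w S)
    (H : ∀ S c, adm S c → ∑ t ∈ S, c t ^ 2 ≤ C) : ∑ t ∈ S, f t ^ 2 ≤ w * C := by
  induction h with
  | empty => simp
  | base a ha h hf =>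
    rw [Finset.sum_congr rfl fun t ht => by rw [hf t ht, mul_pow], ← Finset.mul_sum]
    exact mul_le_mul_of_nonneg_left (H _ _ h) (by positivity)
  | union _ _ hd h1 h2 => rw [Finset.sum_union hd, add_mul]; exact add_le_add h1 h2

theorem sq_le {C : ℝ} (hC : 0 ≤ C) (h : Comb adm f w S)
    (H : ∀ S c, adm S c → ∀ t ∈ S, c t ^ 2 ≤ C) : ∀ t ∈ S, f t ^ 2 ≤ w * C := by
  induction h with
  | empty => simp
  | base a ha h hf =>
    intro t ht
    rw [hf t ht, mul_pow]
    exact mul_le_mul_of_nonneg_left (H _ _ h t ht) (by positivity)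
  | union h h' hd h1 h2 =>
    intro t ht
    have e1 := mul_nonneg h.weight_nonneg hC
    have e2 := mul_nonneg h'.weight_nonneg hC
    rcases Finset.mem_union.1 ht with ht | ht
    · linarith [h1 t ht]
    · linarith [h2 t ht]

theorem nonneg (h : Comb adm f w S) (H : ∀ S c, adm S c → ∀ t ∈ S, 0 ≤ c t) :
    ∀ t ∈ S, 0 ≤ f t := by
  induction h with
  | empty => simp
  | base a ha h hf => intro t ht; rw [hf t ht]; exact mul_nonneg ha (H _ _ h t ht)
  | union _ _ hd h1 h2 =>
    intro t ht
    rcases Finset.mem_union.1 ht with ht | ht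
    exacts [h1 t ht, h2 t ht]

theorem forall_mem {P : ℕ → Prop} (h : Comb adm f w S) (H : ∀ S c, adm S c → ∀ t ∈ S, P t) :
    ∀ t ∈ S, P t := by
  induction h with
  | empty => simp
  | base a ha h hf => exact H _ _ h
  | union _ _ hd h1 h2 =>
    intro t ht
    rcases Finset.mem_union.1 ht with ht | ht
    exacts [h1 t ht, h2 t ht]

/-- Two combinations on disjoint sets can be glued. -/
theorem glue (h : Comb adm f w S) (h' : Comb adm f' w' T) (hd : Disjoint S T) :
    Comb adm (fun t => if t ∈ S then f t else f' t) (w + w') (S ∪ T) := by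
  refine union (h.congr fun t ht => by simp [ht]) (h'.congr fun t ht => ?_) hd
  simp [Finset.disjoint_right.1 hd ht]

/-- A combination of pieces of two kinds splits accordingly. -/
theorem split {admA admB : Finset ℕ → (ℕ → ℝ) → Prop} (h : Comb adm f w S)
    (H : ∀ S c, adm S c → admA S c ∨ admB S c) :
    ∃ w₁ w₂ S₁ S₂, w = w₁ + w₂ ∧ S = S₁ ∪ S₂ ∧ Disjoint S₁ S₂ ∧
      Comb admA f w₁ S₁ ∧ Comb admB f w₂ S₂ := by
  induction h with
  | empty => exact ⟨0, 0, ∅, ∅, by simp, by simp, by simp, empty, empty⟩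
  | @base S c a ha h hf =>
    rcases H _ _ h with h | h
    · exact ⟨a ^ 2, 0, S, ∅, by simp, by simp, by simp, base a ha h hf, empty⟩
    · exact ⟨0, a ^ 2, ∅, S, by simp, by simp, by simp, empty, base a ha h hf⟩
  | union _ _ hd h1 h2 =>
    obtain ⟨w₁, w₂, S₁, S₂, rfl, rfl, hd1, hA, hB⟩ := h1
    obtain ⟨w₁', w₂', S₁', S₂', rfl, rfl, hd2, hA', hB'⟩ := h2
    simp only [Finset.disjoint_union_left, Finset.disjoint_union_right] at hd
    refine ⟨w₁ + w₁', w₂ + w₂', S₁ ∪ S₁', S₂ ∪ S₂', by ring, ?_, ?_,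
      union hA hA' hd.1.1, union hB hB' hd.2.2⟩
    · ext; simp only [Finset.mem_union]; tauto
    · simp only [Finset.disjoint_union_left, Finset.disjoint_union_right]
      exact ⟨⟨hd1, hd.1.2.symm⟩, hd.2.1, hd2⟩

/-- Combinations can be transported along a map that is injective on their support. -/
theorem image {σ : ℕ → ℕ} (h : Comb adm f w S) (f' : ℕ → ℝ) (hσ : Set.InjOn σ S)
    (hf' : ∀ t ∈ S, f' (σ t) = f t)
    (H : ∀ T c c', T ⊆ S → adm T c → (∀ t ∈ T, c' (σ t) = c t) → adm' (T.image σ) c') :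
    Comb adm' f' w (S.image σ) := by
  induction h with
  | empty => simpa using empty
  | @base S c a ha h hf =>
    have hinv : ∀ t ∈ S, c (Function.invFunOn σ S (σ t)) = c t := fun t ht => by
      rw [hσ.leftInvOn_invFunOn ht]
    refine base (c := fun s => c (Function.invFunOn σ S s)) a ha
      (H S c _ subset_rfl h hinv) fun s hs => ?_
    obtain ⟨t, ht, rfl⟩ := Finset.mem_image.1 hs
    rw [hf' t ht, hf t ht]
    simp only [hinv t ht]
  | @union w w' S S' _ _ hd h1 h2 =>
    rw [Finset.image_union]
    have i1 : S ⊆ S ∪ S' := Finset.subset_union_left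
    have i2 : S' ⊆ S ∪ S' := Finset.subset_union_right
    refine union (h1 (hσ.mono i1) (fun t ht => hf' t (i1 ht))
        fun T c c' hT => H T c c' (hT.trans i1))
      (h2 (hσ.mono i2) (fun t ht => hf' t (i2 ht))
        fun T c c' hT => H T c c' (hT.trans i2)) ?_
    rw [Finset.disjoint_left]
    intro s hs hs'
    obtain ⟨t, ht, rfl⟩ := Finset.mem_image.1 hs
    obtain ⟨t', ht', he⟩ := Finset.mem_image.1 hs'
    exact Finset.disjoint_left.1 hd ht (hσ (i2 ht') (i1 ht) he ▸ ht')

end Comb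

/-- A family of admissible weights: weights on finite sets, with values in `[0, 1]`, closed
under restriction and containing the unit weights. -/
structure Gauge where
  adm : Finset ℕ → (ℕ → ℝ) → Prop
  adm_subset : ∀ S T c, S ⊆ T → adm T c → adm S c
  nonneg : ∀ S c, adm S c → ∀ t ∈ S, 0 ≤ c t
  le_one : ∀ S c, adm S c → ∀ t ∈ S, c t ≤ 1
  single : ∀ t, adm {t} fun _ => 1

namespace Gauge

variable (G G' : Gauge) {x y : ℕ → ℝ} {f : ℕ → ℝ} {w : ℝ} {S : Finset ℕ}

/-- The values at `|x|` of the functionals that norm the space. -/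
def vals (x : ℕ → ℝ) : Set ℝ :=
  {v | ∃ f w S, w ≤ 1 ∧ Comb G.adm f w S ∧ v = ∑ t ∈ S, f t * |x t|}

/-- `x` has finite norm. -/
def Mem (x : ℕ → ℝ) : Prop := BddAbove (G.vals x)

/-- The norm of `x`; meaningful when `G.Mem x`. -/
noncomputable def nrm (x : ℕ → ℝ) : ℝ := sSup (G.vals x)

variable {G G'}

theorem zero_mem_vals : (0 : ℝ) ∈ G.vals x := ⟨0, 0, ∅, zero_le_one, Comb.empty, by simp⟩

theorem nrm_nonneg : 0 ≤ G.nrm x := Real.sSup_nonneg' ⟨0, zero_mem_vals, le_rfl⟩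

theorem mem_of {M : ℝ}
    (h : ∀ f w S, w ≤ 1 → Comb G.adm f w S → ∑ t ∈ S, f t * |x t| ≤ M) : G.Mem x := by
  refine ⟨M, ?_⟩
  rintro v ⟨f, w, S, hw, hc, rfl⟩
  exact h f w S hw hc

theorem nrm_le {M : ℝ}
    (h : ∀ f w S, w ≤ 1 → Comb G.adm f w S → ∑ t ∈ S, f t * |x t| ≤ M) : G.nrm x ≤ M := by
  refine csSup_le ⟨0, zero_mem_vals⟩ ?_
  rintro v ⟨f, w, S, hw, hc, rfl⟩
  exact h f w S hw hc

theorem le_nrm (hx : G.Mem x) (hw : w ≤ 1) (h : Comb G.adm f w S) :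
    ∑ t ∈ S, f t * |x t| ≤ G.nrm x :=
  le_csSup hx ⟨f, w, S, hw, h, rfl⟩

theorem le_sqrt_mul_nrm (hx : G.Mem x) (h : Comb G.adm f w S) :
    ∑ t ∈ S, f t * |x t| ≤ √w * G.nrm x := by
  have key : ∀ r : ℝ, 0 ≤ r → r ^ 2 * w ≤ 1 → r * ∑ t ∈ S, f t * |x t| ≤ G.nrm x := by
    intro r hr hrw
    have := le_nrm hx hrw (h.scale hr)
    simpa only [Finset.mul_sum, mul_assoc] using this
  rcases h.weight_nonneg.eq_or_lt with hw | hw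
  · subst hw
    simp only [Real.sqrt_zero, zero_mul]
    by_contra! hlt
    have := key ((G.nrm x + 1) / ∑ t ∈ S, f t * |x t|)
      (div_nonneg (by linarith [nrm_nonneg (G := G) (x := x)]) hlt.le) (by simp)
    rw [div_mul_cancel₀ _ hlt.ne'] at this
    linarith
  · have hs : 0 < √w := Real.sqrt_pos.2 hw
    have := key (√w)⁻¹ (by positivity) (by rw [inv_pow, Real.sq_sqrt hw.le, inv_mul_cancel₀ hw.ne'])
    rwa [inv_mul_le_iff₀ hs] at this

theorem comb_nonneg (h : Comb G.adm f w S) : ∀ t ∈ S, 0 ≤ f t := h.nonneg G.nonneg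

theorem comb_le_one (hw : w ≤ 1) (h : Comb G.adm f w S) : ∀ t ∈ S, f t ≤ 1 := by
  intro t ht
  have := h.sq_le zero_le_one
    (fun S c hc t ht => pow_le_one₀ (G.nonneg S c hc t ht) (G.le_one S c hc t ht)) t ht
  exact (sq_le_one_iff₀ (comb_nonneg h t ht)).1 (by linarith)

theorem comb_subset (h : Comb G.adm f w S) {T : Finset ℕ} (hT : T ⊆ S) : Comb G.adm f w T :=
  h.subset G.adm_subset T hT

theorem comb_of_nonneg (S : Finset ℕ) (hf : ∀ t ∈ S, 0 ≤ f t) :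
    Comb G.adm f (∑ t ∈ S, f t ^ 2) S := by
  induction S using Finset.induction_on with
  | empty => simpa using Comb.empty
  | insert a S ha ih =>
    rw [Finset.sum_insert ha, Finset.insert_eq]
    refine Comb.union (Comb.base (f a) (hf a (by simp)) (G.single a) fun t ht => ?_)
      (ih fun t ht => hf t (by simp [ht])) (by simpa using ha)
    simp [Finset.mem_singleton.1 ht]

theorem sum_sq_le_nrm_sq (hx : G.Mem x) (S : Finset ℕ) : ∑ t ∈ S, x t ^ 2 ≤ G.nrm x ^ 2 := by
  have h := le_sqrt_mul_nrm hx (comb_of_nonneg (f := fun t => |x t|) S fun t _ => abs_nonneg _)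
  simp only [abs_mul_abs_self, sq_abs] at h
  have e : ∑ t ∈ S, x t * x t = ∑ t ∈ S, x t ^ 2 := Finset.sum_congr rfl fun t _ => by ring
  rw [e] at h
  have hQ : 0 ≤ ∑ t ∈ S, x t ^ 2 := Finset.sum_nonneg fun t _ => sq_nonneg _
  have hs := Real.sq_sqrt hQ
  have hn := Real.sqrt_nonneg (∑ t ∈ S, x t ^ 2)
  have h0 := nrm_nonneg (G := G) (x := x)
  set s := √(∑ t ∈ S, x t ^ 2)
  rw [← hs] at h ⊢
  have : s ≤ G.nrm x := by
    rcases hn.eq_or_lt with hs0 | hs0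
    · rw [← hs0]; exact h0
    · exact le_of_mul_le_mul_left (by nlinarith) hs0
  exact pow_le_pow_left₀ hn this 2

theorem abs_le_nrm (hx : G.Mem x) (t : ℕ) : |x t| ≤ G.nrm x := by
  have := sum_sq_le_nrm_sq hx {t}
  rw [Finset.sum_singleton] at this
  exact abs_le_of_sq_le_sq this nrm_nonneg

theorem sum_le_sum_abs (hw : w ≤ 1) (h : Comb G.adm f w S) {p : ℕ} (hx : ∀ t, p ≤ t → x t = 0) :
    ∑ t ∈ S, f t * |x t| ≤ ∑ t ∈ Finset.range p, |x t| := by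
  calc ∑ t ∈ S, f t * |x t| ≤ ∑ t ∈ S, |x t| :=
        Finset.sum_le_sum fun t ht => by
          nlinarith [comb_le_one hw h t ht, abs_nonneg (x t)]
    _ ≤ ∑ t ∈ Finset.range p, |x t| := by
        rw [← Finset.sum_filter_ne_zero]
        refine Finset.sum_le_sum_of_subset_of_nonneg (fun t ht => ?_) fun _ _ _ => abs_nonneg _
        by_contra hp
        exact (Finset.mem_filter.1 ht).2 (by rw [hx t (by simpa using hp), abs_zero])

theorem mem_of_finite {p : ℕ} (hx : ∀ t, p ≤ t → x t = 0) : G.Mem x :=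
  mem_of fun _ _ _ hw h => sum_le_sum_abs hw h hx

theorem nrm_le_sum_abs {p : ℕ} (hx : ∀ t, p ≤ t → x t = 0) :
    G.nrm x ≤ ∑ t ∈ Finset.range p, |x t| :=
  nrm_le fun _ _ _ hw h => sum_le_sum_abs hw h hx

theorem pair_mono (h : Comb G.adm f w S) (hxy : ∀ t ∈ S, |x t| ≤ |y t|) :
    ∑ t ∈ S, f t * |x t| ≤ ∑ t ∈ S, f t * |y t| :=
  Finset.sum_le_sum fun t ht => mul_le_mul_of_nonneg_left (hxy t ht) (comb_nonneg h t ht)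

theorem mem_mono (hy : G.Mem y) (hxy : ∀ t, |x t| ≤ |y t|) : G.Mem x :=
  mem_of fun _ _ _ hw h => (pair_mono h fun t _ => hxy t).trans (le_nrm hy hw h)

theorem nrm_mono (hy : G.Mem y) (hxy : ∀ t, |x t| ≤ |y t|) : G.nrm x ≤ G.nrm y :=
  nrm_le fun _ _ _ hw h => (pair_mono h fun t _ => hxy t).trans (le_nrm hy hw h)

theorem pair_add_le (h : Comb G.adm f w S) :
    ∑ t ∈ S, f t * |(x + y) t| ≤ ∑ t ∈ S, f t * |x t| + ∑ t ∈ S, f t * |y t| := by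
  rw [← Finset.sum_add_distrib]
  refine Finset.sum_le_sum fun t ht => ?_
  rw [← mul_add]
  exact mul_le_mul_of_nonneg_left (abs_add_le _ _) (comb_nonneg h t ht)

theorem pair_add_le_nrm (hx : G.Mem x) (hy : G.Mem y) (hw : w ≤ 1) (h : Comb G.adm f w S) :
    ∑ t ∈ S, f t * |(x + y) t| ≤ G.nrm x + G.nrm y :=
  (pair_add_le h).trans (add_le_add (le_nrm hx hw h) (le_nrm hy hw h))

theorem mem_add (hx : G.Mem x) (hy : G.Mem y) : G.Mem (x + y) :=
  mem_of fun _ _ _ hw h => pair_add_le_nrm hx hy hw h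

theorem nrm_add_le (hx : G.Mem x) (hy : G.Mem y) : G.nrm (x + y) ≤ G.nrm x + G.nrm y :=
  nrm_le fun _ _ _ hw h => pair_add_le_nrm hx hy hw h

theorem pair_smul (c : ℝ) :
    ∑ t ∈ S, f t * |(c • x) t| = |c| * ∑ t ∈ S, f t * |x t| := by
  rw [Finset.mul_sum]
  exact Finset.sum_congr rfl fun t _ => by
    rw [Pi.smul_apply, smul_eq_mul, abs_mul]; ring

theorem mem_smul (hx : G.Mem x) (c : ℝ) : G.Mem (c • x) :=
  mem_of (M := |c| * G.nrm x) fun _ _ _ hw h => by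
    rw [pair_smul]; exact mul_le_mul_of_nonneg_left (le_nrm hx hw h) (abs_nonneg c)

theorem nrm_smul (hx : G.Mem x) (c : ℝ) : G.nrm (c • x) = |c| * G.nrm x := by
  have le : ∀ (c : ℝ) {x}, G.Mem x → G.nrm (c • x) ≤ |c| * G.nrm x := fun c x hx =>
    nrm_le fun _ _ _ hw h => by
      rw [pair_smul]; exact mul_le_mul_of_nonneg_left (le_nrm hx hw h) (abs_nonneg c)
  refine le_antisymm (le c hx) ?_
  rcases eq_or_ne c 0 with rfl | hc
  · simpa using nrm_nonneg
  · have := le c⁻¹ (mem_smul hx c)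
    rw [inv_smul_smul₀ hc, abs_inv] at this
    rwa [le_inv_mul_iff₀ (abs_pos.2 hc)] at this

/-- Comparison of norms along an injection that preserves admissibility. -/
theorem nrm_le_of_image {S₀ : Set ℕ} {σ : ℕ → ℕ} (hy : G'.Mem y) (hσ : Set.InjOn σ S₀)
    (hx : ∀ t, t ∉ S₀ → x t = 0) (hxy : ∀ t ∈ S₀, |x t| ≤ |y (σ t)|)
    (H : ∀ (T : Finset ℕ) (c c' : ℕ → ℝ), ↑T ⊆ S₀ → G.adm T c →
      (∀ t ∈ T, c' (σ t) = c t) → G'.adm (T.image σ) c') : G.nrm x ≤ G'.nrm y := by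
  classical
  refine nrm_le fun f w S hw h => ?_
  set S' := S.filter (· ∈ S₀) with hS'
  have hsub : (S' : Set ℕ) ⊆ S₀ := fun t ht => by simp [hS'] at ht; exact ht.2
  have hinj : Set.InjOn σ S' := hσ.mono hsub
  have h1 : ∑ t ∈ S, f t * |x t| = ∑ t ∈ S', f t * |x t| := by
    refine (Finset.sum_subset (Finset.filter_subset _ _) fun t ht ht' => ?_).symm
    rw [hx t (fun h => ht' (Finset.mem_filter.2 ⟨ht, h⟩)), abs_zero, mul_zero]
  have hinv : ∀ t ∈ S', f (Function.invFunOn σ S' (σ t)) = f t := fun t ht => by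
    rw [hinj.leftInvOn_invFunOn ht]
  have hS'c := comb_subset h (Finset.filter_subset (· ∈ S₀) S)
  have h2 := hS'c.image (adm' := G'.adm)
    (fun s => f (Function.invFunOn σ S' s)) hinj hinv
    fun T c c' hT => H T c c' fun t ht => hsub (hT ht)
  have h3 := le_nrm hy hw h2
  rw [Finset.sum_image hinj] at h3
  rw [h1]
  refine le_trans (Finset.sum_le_sum fun t ht => ?_) h3
  rw [hinv t ht]
  exact mul_le_mul_of_nonneg_left (hxy t (hsub ht)) (comb_nonneg hS'c t ht)

theorem nrm_le_of_adm (H : ∀ S c, G.adm S c → G'.adm S c) (hx : G'.Mem x) :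
    G.nrm x ≤ G'.nrm x :=
  nrm_le fun _ _ _ hw h => le_nrm hx hw (h.imp H)

/-- Lower `2`-estimate for disjoint vectors. -/
theorem nrm_sq_add_nrm_sq_le {I : Set ℕ} {z : ℕ → ℝ} (hz : G.Mem z)
    (hx : ∀ t, t ∉ I → x t = 0) (hy : ∀ t ∈ I, y t = 0)
    (hxz : ∀ t ∈ I, |x t| ≤ |z t|) (hyz : ∀ t, t ∉ I → |y t| ≤ |z t|) :
    G.nrm x ^ 2 + G.nrm y ^ 2 ≤ G.nrm z ^ 2 := by
  classical
  have key : ∀ α β : ℝ, 0 ≤ α → 0 ≤ β → α ^ 2 + β ^ 2 ≤ 1 →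
      α * G.nrm x + β * G.nrm y ≤ G.nrm z := by
    intro α β hα hβ hαβ
    have hpair : ∀ f w S f' w' S', w ≤ 1 → Comb G.adm f w S → w' ≤ 1 → Comb G.adm f' w' S' →
        α * ∑ t ∈ S, f t * |x t| + β * ∑ t ∈ S', f' t * |y t| ≤ G.nrm z := by
      intro f w S f' w' S' hw h hw' h'
      set T := S.filter (· ∈ I)
      set T' := S'.filter (· ∉ I)
      have hd : Disjoint T T' := by
        rw [Finset.disjoint_left]; intro t ht ht'
        exact (Finset.mem_filter.1 ht').2 (Finset.mem_filter.1 ht).2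
      have hT := (comb_subset h (Finset.filter_subset (· ∈ I) S))
      have hT' := (comb_subset h' (Finset.filter_subset (· ∉ I) S'))
      have hg := (hT.scale hα).glue (hT'.scale hβ) hd
      have hww : α ^ 2 * w + β ^ 2 * w' ≤ 1 := by
        nlinarith [sq_nonneg α, sq_nonneg β]
      have hle := le_nrm hz hww hg
      refine le_trans ?_ hle
      rw [Finset.sum_union hd]
      have e1 : ∑ t ∈ S, f t * |x t| = ∑ t ∈ T, f t * |x t| := by
        refine (Finset.sum_subset (Finset.filter_subset _ _) fun t ht ht' => ?_).symm
        rw [hx t (fun h => ht' (Finset.mem_filter.2 ⟨ht, h⟩)), abs_zero, mul_zero]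
      have e2 : ∑ t ∈ S', f' t * |y t| = ∑ t ∈ T', f' t * |y t| := by
        refine (Finset.sum_subset (Finset.filter_subset _ _) fun t ht ht' => ?_).symm
        rw [hy t (by_contra fun h => ht' (Finset.mem_filter.2 ⟨ht, h⟩)), abs_zero, mul_zero]
      rw [e1, e2, Finset.mul_sum, Finset.mul_sum]
      refine add_le_add (Finset.sum_le_sum fun t ht => ?_) (Finset.sum_le_sum fun t ht => ?_)
      · rw [if_pos ht, ← mul_assoc]
        exact mul_le_mul_of_nonneg_left (hxz t (Finset.mem_filter.1 ht).2)
          (mul_nonneg hα (comb_nonneg hT t ht))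
      · rw [if_neg (Finset.disjoint_right.1 hd ht), ← mul_assoc]
        exact mul_le_mul_of_nonneg_left (hyz t (Finset.mem_filter.1 ht).2)
          (mul_nonneg hβ (comb_nonneg hT' t ht))
    have scaled : ∀ (γ K : ℝ) (u : ℕ → ℝ), 0 ≤ γ →
        (∀ f w S, w ≤ 1 → Comb G.adm f w S → γ * ∑ t ∈ S, f t * |u t| ≤ K) →
        γ * G.nrm u ≤ K := by
      intro γ K u hγ h
      rcases hγ.eq_or_lt with rfl | hγ
      · have := h 0 0 ∅ zero_le_one Comb.empty
        simpa using this
      · rw [← le_div_iff₀' hγ]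
        exact nrm_le fun f w S hw hc => by
          rw [le_div_iff₀' hγ]; exact h f w S hw hc
    have h1 : ∀ f' w' S', w' ≤ 1 → Comb G.adm f' w' S' →
        α * G.nrm x ≤ G.nrm z - β * ∑ t ∈ S', f' t * |y t| := by
      intro f' w' S' hw' h'
      refine scaled _ _ _ hα fun f w S hw h => ?_
      linarith [hpair f w S f' w' S' hw h hw' h']
    have h2 : β * G.nrm y ≤ G.nrm z - α * G.nrm x :=
      scaled _ _ _ hβ fun f w S hw h => by linarith [h1 f w S hw h]
    linarith
  have hx0 := nrm_nonneg (G := G) (x := x)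
  have hy0 := nrm_nonneg (G := G) (x := y)
  set Q := G.nrm x ^ 2 + G.nrm y ^ 2 with hQ
  have hQ0 : 0 ≤ Q := by positivity
  have hs := Real.sq_sqrt hQ0
  rcases hQ0.eq_or_lt with h0 | h0
  · rw [← h0]; positivity
  · have hs0 : 0 < √Q := Real.sqrt_pos.2 h0
    have := key (G.nrm x / √Q) (G.nrm y / √Q) (by positivity) (by positivity) (by
      rw [div_pow, div_pow, hs, ← add_div, ← hQ, div_self h0.ne'])
    have e : G.nrm x / √Q * G.nrm x + G.nrm y / √Q * G.nrm y = √Q := by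
      field_simp; linarith
    rw [e] at this
    calc Q = √Q ^ 2 := hs.symm
      _ ≤ G.nrm z ^ 2 := pow_le_pow_left₀ hs0.le this 2

/-- Almost upper `2`-estimate, from a splitting of every norming functional. -/
theorem nrm_add_le_of_split {η : ℝ} (hx : G.Mem x) (hy : G.Mem y)
    (H : ∀ f w S, w ≤ 1 → Comb G.adm f w S → ∃ w₁ w₂ S₁ S₂, w = w₁ + w₂ ∧ S = S₁ ∪ S₂ ∧
      Disjoint S₁ S₂ ∧ Comb G.adm f w₁ S₁ ∧ Comb G.adm f w₂ S₂ ∧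
      ∑ t ∈ S₁, f t * |y t| + ∑ t ∈ S₂, f t * |x t| ≤ η) :
    G.nrm (x + y) ≤ √(G.nrm x ^ 2 + G.nrm y ^ 2) + η := by
  refine nrm_le fun f w S hw h => ?_
  obtain ⟨w₁, w₂, S₁, S₂, rfl, rfl, hd, h1, h2, hη⟩ := H f w S hw h
  refine (pair_add_le h).trans ?_
  rw [Finset.sum_union hd, Finset.sum_union hd]
  have a1 := le_sqrt_mul_nrm hx h1
  have a2 := le_sqrt_mul_nrm hy h2
  have cs : √w₁ * G.nrm x + √w₂ * G.nrm y ≤ √(G.nrm x ^ 2 + G.nrm y ^ 2) := by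
    refine Real.le_sqrt_of_sq_le ?_
    have s1 := Real.sq_sqrt h1.weight_nonneg
    have s2 := Real.sq_sqrt h2.weight_nonneg
    nlinarith [sq_nonneg (√w₁ * G.nrm y - √w₂ * G.nrm x), sq_nonneg (G.nrm x),
      sq_nonneg (G.nrm y)]
  linarith

end Gauge

namespace Gauge

variable {G : Gauge}

/-- The vectors of finite norm. -/
def space (G : Gauge) : Submodule ℝ (ℕ → ℝ) where
  carrier := {x | G.Mem x}
  add_mem' := mem_add
  zero_mem' := mem_of_finite (p := 0) fun _ _ => rfl
  smul_mem' c _ hx := mem_smul hx c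

/-- The sup of the functionals is lower semicontinuous for coordinatewise convergence. -/
theorem pair_le_of_tendsto {ι : Type*} {l : Filter ι} [l.NeBot] {z : ι → ℕ → ℝ} {x : ℕ → ℝ} {M : ℝ}
    (hz : ∀ t, Tendsto (fun k => z k t) l (𝓝 (x t)))
    (hM : ∀ᶠ k in l, G.Mem (z k) ∧ G.nrm (z k) ≤ M) {f : ℕ → ℝ} {w : ℝ} {S : Finset ℕ}
    (hw : w ≤ 1) (h : Comb G.adm f w S) : ∑ t ∈ S, f t * |x t| ≤ M := by
  refine le_of_tendsto (tendsto_finsetSum S fun t _ => ((hz t).abs.const_mul (f t))) ?_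
  filter_upwards [hM] with k hk
  exact (le_nrm hk.1 hw h).trans hk.2

theorem exists_nrm_restrict_ge {x : ℕ → ℝ} {δ : ℝ} (hδ : 0 < δ) :
    ∃ p, ∀ q, p ≤ q → G.nrm x - δ ≤ G.nrm ((Set.Iio q).indicator x) := by
  obtain ⟨_, ⟨f, w, S, hw, hc, rfl⟩, hlt⟩ :=
    exists_lt_of_lt_csSup (s := G.vals x) ⟨0, zero_mem_vals⟩ (sub_lt_self (sSup (G.vals x)) hδ)
  refine ⟨S.sup id + 1, fun q hq => hlt.le.trans ?_⟩
  have hm : G.Mem ((Set.Iio q).indicator x) :=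
    mem_of_finite (p := q) fun t ht => Set.indicator_of_notMem (by simpa using ht) _
  refine le_trans (Finset.sum_le_sum fun t ht => ?_) (le_nrm hm hw hc)
  have : t ≤ S.sup id := Finset.le_sup (f := id) ht
  rw [Set.indicator_of_mem (show t ∈ Set.Iio q by simp; omega)]

end Gauge

/-- The space of vectors of finite norm, with its norm. -/
def Sp (G : Gauge) : Type := G.space

namespace Sp

variable {G : Gauge}

instance : AddCommGroup (Sp G) := inferInstanceAs (AddCommGroup G.space)
instance : Module ℝ (Sp G) := inferInstanceAs (Module ℝ G.space)

/-- The coordinates of a vector. -/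
def val : Sp G →ₗ[ℝ] (ℕ → ℝ) := G.space.subtype

/-- The vector with given coordinates. -/
def mk (x : ℕ → ℝ) (h : G.Mem x) : Sp G := ⟨x, h⟩

@[simp] theorem val_mk (x : ℕ → ℝ) (h : G.Mem x) : val (mk x h) = x := rfl

theorem mem (x : Sp G) : G.Mem (val x) := x.2

@[ext] theorem ext {x y : Sp G} (h : ∀ t, val x t = val y t) : x = y :=
  Subtype.ext (funext h)

noncomputable instance : Norm (Sp G) := ⟨fun x => G.nrm (val x)⟩

theorem norm_def (x : Sp G) : ‖x‖ = G.nrm (val x) := rfl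

theorem abs_val_le_norm (x : Sp G) (t : ℕ) : |val x t| ≤ ‖x‖ := G.abs_le_nrm x.mem t

theorem core (G : Gauge) : NormedSpace.Core ℝ (Sp G) where
  norm_nonneg _ := G.nrm_nonneg
  norm_smul c x := by
    rw [norm_def, map_smul, Gauge.nrm_smul x.mem, Real.norm_eq_abs, norm_def]
  norm_triangle x y := by
    rw [norm_def, map_add]; exact Gauge.nrm_add_le x.mem y.mem
  norm_eq_zero_iff x := by
    constructor
    · intro h
      ext t
      have := abs_val_le_norm x t
      rw [h] at this
      simpa using this
    · rintro rfl
      rw [norm_def, map_zero]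
      refine le_antisymm ?_ G.nrm_nonneg
      simpa using Gauge.nrm_le_sum_abs (G := G) (x := 0) (p := 0) fun _ _ => rfl

noncomputable instance : NormedAddCommGroup (Sp G) := NormedAddCommGroup.ofCore (core G)
noncomputable instance : NormedSpace ℝ (Sp G) := NormedSpace.ofCore (core G)

theorem norm_le {x : Sp G} {M : ℝ}
    (h : ∀ f w S, w ≤ 1 → Comb G.adm f w S → ∑ t ∈ S, f t * |val x t| ≤ M) : ‖x‖ ≤ M :=
  Gauge.nrm_le h

theorem le_norm (x : Sp G) {f : ℕ → ℝ} {w : ℝ} {S : Finset ℕ} (hw : w ≤ 1)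
    (h : Comb G.adm f w S) : ∑ t ∈ S, f t * |val x t| ≤ ‖x‖ := Gauge.le_nrm x.mem hw h

theorem norm_mono {x y : Sp G} (h : ∀ t, |val x t| ≤ |val y t|) : ‖x‖ ≤ ‖y‖ :=
  Gauge.nrm_mono y.mem h

instance : CompleteSpace (Sp G) := by
  refine Metric.complete_of_cauchySeq_tendsto fun u hu => ?_
  have hc : ∀ t, ∃ a, Tendsto (fun n => val (u n) t) atTop (𝓝 a) := fun t => by
    refine cauchySeq_tendsto_of_complete ?_
    rw [Metric.cauchySeq_iff] at hu ⊢
    intro ε hε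
    obtain ⟨N, hN⟩ := hu ε hε
    refine ⟨N, fun m hm n hn => lt_of_le_of_lt ?_ (hN m hm n hn)⟩
    rw [dist_eq_norm, dist_eq_norm, Real.norm_eq_abs, ← Pi.sub_apply, ← map_sub]
    exact abs_val_le_norm _ _
  choose x hx using hc
  have key : ∀ ε > 0, ∃ N, ∀ n ≥ N, ∀ f w S, w ≤ 1 → Comb G.adm f w S →
      ∑ t ∈ S, f t * |(val (u n) - x) t| ≤ ε := by
    intro ε hε
    obtain ⟨N, hN⟩ := Metric.cauchySeq_iff.1 hu ε hε
    refine ⟨N, fun n hn f w S hw hc => Gauge.pair_le_of_tendsto (l := atTop)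
      (z := fun m => val (u n) - val (u m)) (fun t => (hx t).const_sub _) ?_ hw hc⟩
    filter_upwards [eventually_ge_atTop N] with m hm
    rw [← map_sub]
    refine ⟨mem _, ?_⟩
    have := hN n hn m hm
    rw [dist_eq_norm] at this
    exact this.le
  have hmem : G.Mem x := by
    obtain ⟨N, hN⟩ := key 1 one_pos
    have h := G.space.sub_mem (mem (u N)) (Gauge.mem_of (hN N le_rfl))
    rwa [sub_sub_cancel] at h
  refine ⟨mk x hmem, Metric.tendsto_atTop.2 fun ε hε => ?_⟩
  obtain ⟨N, hN⟩ := key (ε / 2) (by positivity)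
  refine ⟨N, fun n hn => ?_⟩
  rw [dist_eq_norm]
  refine lt_of_le_of_lt (norm_le fun f w S hw hc => ?_) (half_lt_self hε)
  exact hN n hn f w S hw hc

/-- The coordinates as continuous functionals. -/
noncomputable def coord (G : Gauge) (t : ℕ) : Sp G →L[ℝ] ℝ :=
  LinearMap.mkContinuous ((LinearMap.proj t).comp val) 1 fun x => by
    simpa using abs_val_le_norm x t

@[simp] theorem coord_apply (t : ℕ) (x : Sp G) : coord G t x = val x t := rfl

/-- The restriction of a vector to a set of coordinates. -/
noncomputable def restrict (I : Set ℕ) : Sp G →ₗ[ℝ] Sp G where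
  toFun x := mk (I.indicator (val x)) (Gauge.mem_mono x.mem fun t => by
    by_cases h : t ∈ I <;> simp [h])
  map_add' x y := by ext t; by_cases h : t ∈ I <;> simp [h]
  map_smul' c x := by ext t; by_cases h : t ∈ I <;> simp [h]

@[simp] theorem val_restrict (I : Set ℕ) (x : Sp G) : val (restrict I x) = I.indicator (val x) :=
  rfl

theorem norm_restrict_le (I : Set ℕ) (x : Sp G) : ‖restrict I x‖ ≤ ‖x‖ :=
  norm_mono fun t => by by_cases h : t ∈ I <;> simp [h]

/-- Lower `2`-estimate for disjoint vectors. -/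
theorem norm_sq_restrict_add_le (I : Set ℕ) (x : Sp G) :
    ‖restrict I x‖ ^ 2 + ‖x - restrict I x‖ ^ 2 ≤ ‖x‖ ^ 2 :=
  Gauge.nrm_sq_add_nrm_sq_le (I := I) x.mem (fun t h => by simp [h]) (fun t h => by simp [h])
    (fun t h => by simp [h]) (fun t h => by simp [h])

theorem tendsto_restrict (x : Sp G) :
    Tendsto (fun p => restrict (Set.Iio p) x) atTop (𝓝 x) := by
  have h1 : Tendsto (fun p => ‖restrict (Set.Iio p) x‖) atTop (𝓝 ‖x‖) := by
    rw [Metric.tendsto_atTop]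
    intro ε hε
    obtain ⟨p, hp⟩ := Gauge.exists_nrm_restrict_ge (G := G) (x := val x) (half_pos hε)
    refine ⟨p, fun q hq => ?_⟩
    have a1 := hp q hq
    have a2 := norm_restrict_le (Set.Iio q) x
    rw [Real.dist_eq, abs_lt]
    rw [norm_def, norm_def, val_restrict] at *
    constructor <;> linarith
  have h2 : Tendsto (fun p => ‖x‖ ^ 2 - ‖restrict (Set.Iio p) x‖ ^ 2) atTop (𝓝 0) := by
    have h := (h1.pow 2).const_sub (‖x‖ ^ 2)
    rwa [sub_self] at h
  have h3 : Tendsto (fun p => ‖x - restrict (Set.Iio p) x‖ ^ 2) atTop (𝓝 0) :=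
    squeeze_zero (fun _ => sq_nonneg _)
      (fun p => by linarith [norm_sq_restrict_add_le (Set.Iio p) x]) h2
  rw [tendsto_iff_norm_sub_tendsto_zero]
  have h4 := h3.sqrt
  simp only [Real.sqrt_sq (norm_nonneg _), Real.sqrt_zero] at h4
  simpa only [norm_sub_rev] using h4

/-- The unit vectors. -/
noncomputable def e (G : Gauge) (i : ℕ) : Sp G :=
  mk (Pi.single i 1) (Gauge.mem_of_finite (p := i + 1) fun t ht => by
    rw [Pi.single_eq_of_ne (by omega)])

@[simp] theorem val_e (i : ℕ) : val (e G i) = Pi.single i 1 := rfl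

theorem val_sum_e {n : ℕ} (a : ℕ → ℝ) (t : ℕ) :
    val (∑ i ∈ Finset.range n, a i • e G i) t = if t < n then a t else 0 := by
  rw [map_sum, Finset.sum_apply]
  simp [Pi.single_apply]

theorem norm_e (i : ℕ) : ‖e G i‖ = 1 := by
  refine le_antisymm (norm_le fun f w S hw hc => ?_) ?_
  · by_cases hi : i ∈ S
    · rw [Finset.sum_eq_single_of_mem i hi (fun t _ ht => by simp [ht])]
      simpa using Gauge.comb_le_one hw hc i hi
    · rw [Finset.sum_eq_zero fun t ht => ?_]
      · exact zero_le_one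
      · rw [val_e, Pi.single_eq_of_ne (by rintro rfl; exact hi ht)]; simp
  · simpa using abs_val_le_norm (e G i) i

theorem isCBasic_of_disjoint {v : ℕ → Sp G} (hv : ∀ i, v i ≠ 0)
    (hd : ∀ i j t, i ≠ j → val (v i) t = 0 ∨ val (v j) t = 0) : IsCBasic 1 v := by
  refine ⟨hv, fun n m hnm a => ?_⟩
  rw [one_mul]
  refine norm_mono fun t => ?_
  simp only [map_sum, map_smul, Finset.sum_apply, Pi.smul_apply, smul_eq_mul]
  by_cases h : ∃ i ∈ Finset.range n, val (v i) t ≠ 0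
  · obtain ⟨i, hi, hne⟩ := h
    have hz : ∀ j, j ≠ i → a j * val (v j) t = 0 := fun j hj => by
      rw [(hd j i t hj).resolve_right hne, mul_zero]
    rw [Finset.sum_eq_single_of_mem i hi fun j _ hj => hz j hj,
      Finset.sum_eq_single_of_mem i (by simp at hi ⊢; omega) fun j _ hj => hz j hj]
  · push Not at h
    rw [Finset.sum_eq_zero fun i hi => by rw [h i hi, mul_zero], abs_zero]
    exact abs_nonneg _

theorem isCBasic_e : IsCBasic 1 (e G) := by
  refine isCBasic_of_disjoint (fun i h => ?_) fun i j t hij => ?_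
  · have := norm_e (G := G) i
    rw [h, norm_zero] at this
    exact zero_ne_one this
  · by_cases h : t = i
    · right; subst h; simp [hij]
    · left; simp [h]

theorem restrict_Iio_eq (p : ℕ) (x : Sp G) :
    restrict (Set.Iio p) x = ∑ i ∈ Finset.range p, val x i • e G i := by
  ext t
  rw [val_sum_e]
  by_cases h : t < p <;> simp [h]

theorem dense_span_e : Dense (Submodule.span ℝ (Set.range (e G)) : Set (Sp G)) := fun x =>
  mem_closure_of_tendsto (tendsto_restrict x) (Eventually.of_forall fun p => by
    rw [restrict_Iio_eq]
    exact Submodule.sum_mem _ fun i _ => Submodule.smul_mem _ _ (Submodule.subset_span ⟨i, rfl⟩))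

theorem isSchauderBasis_e : IsSchauderBasis (e G) := ⟨⟨1, isCBasic_e⟩, dense_span_e⟩

instance : TopologicalSpace.SeparableSpace (Sp G) := by
  have h : TopologicalSpace.IsSeparable (Submodule.span ℝ (Set.range (e G)) : Set (Sp G)) :=
    (Set.countable_range _).isSeparable.span
  have h2 := h.closure
  rw [dense_span_e.closure_eq] at h2
  exact TopologicalSpace.isSeparable_univ_iff.1 h2

theorem tendsto_val_zero (x : Sp G) : Tendsto (val x) atTop (𝓝 0) := by
  have h := (tendsto_iff_norm_sub_tendsto_zero.1 (tendsto_restrict x))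
  refine squeeze_zero_norm (fun t => ?_) h
  have := abs_val_le_norm (restrict (Set.Iio t) x - x) t
  simpa using this

end Sp

/-- Convex sets of finitely supported unit-ball vectors that reach arbitrarily far out contain
far-out vectors of small norm. -/
def Gauge.Small (G : Gauge) : Prop :=
  ∀ U : Set (ℕ → ℝ), Convex ℝ U → (∀ u ∈ U, (∃ p, ∀ t, p ≤ t → u t = 0) ∧ G.nrm u ≤ 1) →
    (∀ N, ∃ u ∈ U, ∀ t < N, u t = 0) →
    ∀ N, ∀ ε > 0, ∃ u ∈ U, (∀ t < N, u t = 0) ∧ G.nrm u ≤ ε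

namespace Sp

variable {G : Gauge}

/-- The tail of a functional. -/
noncomputable def tail (g : StrongDual ℝ (Sp G)) (q : ℕ) : StrongDual ℝ (Sp G) :=
  g - ∑ t ∈ Finset.range q, g (e G t) • coord G t

theorem tail_apply (g : StrongDual ℝ (Sp G)) (q : ℕ) (y : Sp G) :
    tail g q y = g (y - restrict (Set.Iio q) y) := by
  rw [restrict_Iio_eq, map_sub, map_sum]
  simp [tail, mul_comm]

theorem exists_norm_tail_le (hG : G.Small) (g : StrongDual ℝ (Sp G)) {δ : ℝ} (hδ : 0 < δ) :
    ∃ p, ∀ q, p ≤ q → ‖tail g q‖ ≤ δ := by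
  by_contra! H
  have hconv : Convex ℝ {y : Sp G | (∃ p, ∀ t, p ≤ t → val y t = 0) ∧ ‖y‖ ≤ 1 ∧ δ ≤ g y} := by
    rintro y ⟨⟨p, hp⟩, hy, hgy⟩ z ⟨⟨q, hq⟩, hz, hgz⟩ a b ha hb hab
    refine ⟨⟨max p q, fun t ht => ?_⟩, ?_, ?_⟩
    · simp [hp t (le_trans (le_max_left _ _) ht), hq t (le_trans (le_max_right _ _) ht)]
    · refine (norm_add_le _ _).trans ?_
      rw [norm_smul, norm_smul, Real.norm_of_nonneg ha, Real.norm_of_nonneg hb]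
      nlinarith
    · rw [map_add, map_smul, map_smul, smul_eq_mul, smul_eq_mul]
      nlinarith
  obtain ⟨_, ⟨y, ⟨-, -, hgy⟩, rfl⟩, -, hs⟩ := hG _ (hconv.linear_image val)
    (by rintro _ ⟨y, ⟨hp, hy, -⟩, rfl⟩; exact ⟨hp, hy⟩) (fun N => by
      obtain ⟨q, hNq, hq⟩ := H N
      obtain ⟨y, hy1, hy⟩ : ∃ y : Sp G, ‖y‖ ≤ 1 ∧ δ < tail g q y := by
        by_contra! hcon
        refine hq.not_ge (ContinuousLinearMap.opNorm_le_of_unit_norm hδ.le fun y hy => ?_)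
        rw [Real.norm_eq_abs, abs_le]
        have h2 := hcon (-y) (by rw [norm_neg]; exact hy.le)
        rw [map_neg] at h2
        exact ⟨by linarith, hcon y hy.le⟩
      rw [tail_apply] at hy
      set y' := y - restrict (Set.Iio q) y with hy'
      have hy'1 : ‖y'‖ ≤ 1 :=
        (norm_mono fun t => by by_cases h : t < q <;> simp [hy', h]).trans hy1
      have ht := (g.continuous.tendsto y').comp (tendsto_restrict y')
      obtain ⟨p, hp⟩ := (ht.eventually (lt_mem_nhds hy)).exists
      refine ⟨_, ⟨restrict (Set.Iio p) y',
        ⟨⟨p, fun t ht => by simp [ht]⟩, (norm_restrict_le _ _).trans hy'1, hp.le⟩, rfl⟩,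
        fun t htN => ?_⟩
      have : t < q := by omega
      by_cases h : t < p <;> simp [hy', h, this]) 0 (δ / (2 * (‖g‖ + 1))) (by positivity)
  have h1 : ‖y‖ ≤ δ / (2 * (‖g‖ + 1)) := hs
  have h2 := (le_abs_self _).trans (g.le_opNorm y)
  have h3 : ‖g‖ * ‖y‖ ≤ ‖g‖ * (δ / (2 * (‖g‖ + 1))) :=
    mul_le_mul_of_nonneg_left h1 (norm_nonneg _)
  have h4 : ‖g‖ * (δ / (2 * (‖g‖ + 1))) < δ := by
    rw [mul_div_assoc', div_lt_iff₀ (by positivity)]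
    nlinarith [norm_nonneg g]
  linarith

theorem isReflexive (hG : G.Small) : IsReflexive (Sp G) := by
  intro φ
  set x : ℕ → ℝ := fun t => φ (coord G t) with hx
  have hmem : G.Mem x := by
    refine Gauge.mem_of (M := ‖φ‖) fun f w S hw hc => ?_
    set h : StrongDual ℝ (Sp G) := ∑ t ∈ S, (f t * SignType.sign (x t)) • coord G t with hh
    have e1 : ∑ t ∈ S, f t * |x t| = φ h := by
      rw [hh, map_sum]
      refine Finset.sum_congr rfl fun t _ => ?_
      rw [map_smul, smul_eq_mul, mul_assoc]
      change f t * |x t| = f t * (_ * x t)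
      rw [sign_mul_self]
    have e2 : ‖h‖ ≤ 1 := by
      refine ContinuousLinearMap.opNorm_le_bound _ zero_le_one fun y => ?_
      rw [one_mul, hh, _root_.sum_apply]
      refine (norm_sum_le _ _).trans (le_trans (Finset.sum_le_sum fun t ht => ?_) (le_norm y hw hc))
      rw [_root_.smul_apply, smul_eq_mul, coord_apply, norm_mul, norm_mul]
      have f0 := Gauge.comb_nonneg hc t ht
      rw [Real.norm_of_nonneg f0, Real.norm_eq_abs, Real.norm_eq_abs]
      have : |((SignType.sign (x t) : SignType) : ℝ)| ≤ 1 := by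
        rcases SignType.sign (x t) with _ | _ | _ <;> simp
      have := mul_le_mul_of_nonneg_left this f0
      nlinarith [abs_nonneg (val y t)]
    rw [e1]
    calc φ h ≤ ‖φ h‖ := le_abs_self _
      _ ≤ ‖φ‖ * ‖h‖ := φ.le_opNorm h
      _ ≤ ‖φ‖ := mul_le_of_le_one_right (norm_nonneg φ) e2
  refine ⟨mk x hmem, ?_⟩
  ext g
  rw [NormedSpace.dual_def]
  have h1 : Tendsto (fun p => g (restrict (Set.Iio p) (mk x hmem))) atTop (𝓝 (g (mk x hmem))) :=
    (g.continuous.tendsto _).comp (tendsto_restrict _)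
  have h2 : Tendsto (fun p => φ (g - tail g p)) atTop (𝓝 (φ g)) := by
    have : Tendsto (fun p => g - tail g p) atTop (𝓝 g) := by
      have h0 : Tendsto (tail g) atTop (𝓝 0) := by
        rw [tendsto_zero_iff_norm_tendsto_zero, Metric.tendsto_atTop]
        intro ε hε
        obtain ⟨p, hp⟩ := exists_norm_tail_le hG g (half_pos hε)
        refine ⟨p, fun q hq => ?_⟩
        rw [Real.dist_eq, sub_zero, abs_norm]
        linarith [hp q hq]
      simpa using h0.const_sub g
    exact (φ.continuous.tendsto _).comp this
  refine tendsto_nhds_unique h1 (h2.congr fun p => ?_)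
  rw [restrict_Iio_eq, map_sum, tail, sub_sub_cancel, map_sum]
  refine Finset.sum_congr rfl fun t _ => ?_
  rw [map_smul, map_smul, smul_eq_mul, smul_eq_mul, mul_comm]
  rfl

end Sp

namespace Gauge

variable {G G' : Gauge}

theorem mem_of_bounded_support {x : ℕ → ℝ} (h : ∃ p, ∀ t, p ≤ t → x t = 0) : G.Mem x :=
  h.elim fun _ hp => mem_of_finite hp

/-- An almost upper `2`-estimate for a fixed finite vector and a far-out vector at which `σ` is
small. -/
def UpperStep (G : Gauge) (σ : (ℕ → ℝ) → ℝ) : Prop :=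
  ∀ (x : ℕ → ℝ) (p : ℕ), (∀ t, p ≤ t → x t = 0) → ∀ η > 0, ∃ N, ∃ δ > 0, ∀ y : ℕ → ℝ,
    (∃ q, ∀ t, q ≤ t → y t = 0) → (∀ t < N, y t = 0) → σ y ≤ δ →
    G.nrm (x + y) ≤ √(G.nrm x ^ 2 + G.nrm y ^ 2) + η

theorem UpperStep.exists_nrm_le {σ : (ℕ → ℝ) → ℝ} (hstep : G.UpperStep σ) {U : Set (ℕ → ℝ)}
    (hU : Convex ℝ U) (hUb : ∀ u ∈ U, (∃ p, ∀ t, p ≤ t → u t = 0) ∧ G.nrm u ≤ 1)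
    (hσ : ∀ N, ∀ δ > 0, ∃ z ∈ U, (∀ t < N, z t = 0) ∧ σ z ≤ δ) (N : ℕ) {ε : ℝ} (hε : 0 < ε) :
    ∃ u ∈ U, (∀ t < N, u t = 0) ∧ G.nrm u ≤ ε := by
  have key : ∀ M : ℕ, ∃ u ∈ U, (∀ t < N, u t = 0) ∧
      (M + 1 : ℝ) * G.nrm u ≤ √(M + 1) + (M + 1) * (ε / 2) := by
    intro M
    induction M with
    | zero =>
      obtain ⟨u, hu, hN, -⟩ := hσ N 1 one_pos
      refine ⟨u, hu, hN, ?_⟩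
      have := (hUb u hu).2
      norm_num
      linarith
    | succ M ih =>
      obtain ⟨u, hu, huN, hnu⟩ := ih
      obtain ⟨⟨p, hp⟩, -⟩ := hUb u hu
      have hM : (0 : ℝ) < M + 1 := by positivity
      have hmu : G.Mem u := mem_of_finite hp
      obtain ⟨N', δ, hδ, h⟩ := hstep ((M + 1 : ℝ) • u) p
        (fun t ht => by simp [hp t ht]) (ε / 2) (by positivity)
      obtain ⟨z, hz, hzN, hzδ⟩ := hσ (max N N') δ hδ
      have h1 := h z (hUb z hz).1 (fun t ht => hzN t (lt_max_of_lt_right ht)) hzδ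
      have hz1 := (hUb z hz).2
      have hz0 := nrm_nonneg (G := G) (x := z)
      refine ⟨((M + 1 : ℝ) / (M + 2)) • u + ((1 : ℝ) / (M + 2)) • z,
        hU hu hz (by positivity) (by positivity) (by field_simp; ring), fun t ht => ?_, ?_⟩
      · simp [huN t ht, hzN t (lt_max_of_lt_left ht)]
      · have e1 : ((M + 1 : ℝ) / (M + 2)) • u + ((1 : ℝ) / (M + 2)) • z =
            ((1 : ℝ) / (M + 2)) • ((M + 1 : ℝ) • u + z) := by
          rw [smul_add, smul_smul]; congr 2; ring
        have hmz : G.Mem z := mem_of_bounded_support (hUb z hz).1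
        rw [e1, nrm_smul (mem_add (mem_smul hmu _) hmz), abs_of_nonneg (by positivity)]
        rw [nrm_smul hmu, abs_of_pos hM] at h1
        push_cast
        have e2 : ((M : ℝ) + 1 + 1) * (1 / (M + 2) * G.nrm ((M + 1 : ℝ) • u + z)) =
            G.nrm ((M + 1 : ℝ) • u + z) := by
          field_simp; ring
        rw [e2]
        refine h1.trans ?_
        have s1 := Real.sq_sqrt hM.le
        have s2 := Real.sq_sqrt (show (0 : ℝ) ≤ M + 1 + 1 by positivity)
        have s0 := Real.sqrt_nonneg ((M : ℝ) + 1)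
        have s3 := Real.sqrt_nonneg ((M : ℝ) + 1 + 1)
        have s4 : √((M : ℝ) + 1) ≤ √((M : ℝ) + 1 + 1) := Real.sqrt_le_sqrt (by linarith)
        have hu0 := nrm_nonneg (G := G) (x := u)
        have hsq : √(((M + 1 : ℝ) * G.nrm u) ^ 2 + G.nrm z ^ 2) ≤
            √((M : ℝ) + 1 + 1) + (M + 1) * (ε / 2) := by
          refine Real.sqrt_le_iff.2 ⟨by positivity, ?_⟩
          have q1 : ((M + 1 : ℝ) * G.nrm u) ^ 2 ≤ (√(M + 1) + (M + 1) * (ε / 2)) ^ 2 :=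
            pow_le_pow_left₀ (by positivity) hnu 2
          have q2 : G.nrm z ^ 2 ≤ 1 := pow_le_one₀ hz0 hz1
          have q3 : √((M : ℝ) + 1) * ((M + 1) * (ε / 2)) ≤
              √((M : ℝ) + 1 + 1) * ((M + 1) * (ε / 2)) :=
            mul_le_mul_of_nonneg_right s4 (by positivity)
          nlinarith
        linarith
  obtain ⟨M, hM⟩ := exists_nat_gt ((2 / ε) ^ 2)
  obtain ⟨u, hu, huN, h⟩ := key M
  refine ⟨u, hu, huN, ?_⟩
  have hMp : (0 : ℝ) < M + 1 := by positivity
  have s1 := Real.mul_self_sqrt hMp.le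
  have s0 : 0 < √((M : ℝ) + 1) := Real.sqrt_pos.2 hMp
  have s2 : 2 / ε ≤ √((M : ℝ) + 1) := Real.le_sqrt_of_sq_le (by linarith)
  rw [div_le_iff₀ hε] at s2
  have : (M + 1 : ℝ) * G.nrm u ≤ (M + 1) * ε := by nlinarith
  exact le_of_mul_le_mul_left this hMp

theorem Small.of_upperStep {σ : (ℕ → ℝ) → ℝ} (hG : G.Small)
    (hadm : ∀ S c, G.adm S c → G'.adm S c)
    (hσ : ∀ y, (∃ q, ∀ t, q ≤ t → y t = 0) → σ y ≤ G.nrm y) (hstep : G'.UpperStep σ) :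
    G'.Small := by
  intro U hU hUb hN N ε hε
  refine hstep.exists_nrm_le hU hUb (fun N δ hδ => ?_) N hε
  obtain ⟨u, hu, huN, h⟩ := hG U hU (fun u hu => ⟨(hUb u hu).1,
    (nrm_le_of_adm hadm (mem_of_bounded_support (hUb u hu).1)).trans (hUb u hu).2⟩) hN N δ hδ
  exact ⟨u, hu, huN, (hσ u (hUb u hu).1).trans h⟩

end Gauge

/-! ### The parameters -/

/-- The coefficients of the admissible functionals. -/
noncomputable def theta (i : ℕ) : ℝ := ((i.factorial : ℕ) : ℝ)⁻¹

theorem theta_pos (i : ℕ) : 0 < theta i := by unfold theta; positivity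

theorem theta_anti : Antitone theta := fun i j h => by
  unfold theta
  gcongr

theorem theta_zero : theta 0 = 1 := by simp [theta]

theorem theta_le_one (i : ℕ) : theta i ≤ 1 := theta_zero ▸ theta_anti (Nat.zero_le i)

/-- The partial sums of the sizes of the admissible functionals. -/
def sizeSum : ℕ → ℕ
  | 0 => 0
  | i + 1 => sizeSum i + (i + 1) ^ 2 * i.factorial ^ 2 * (sizeSum i + 1)

/-- The sizes of the supports of the admissible functionals. -/
def size (i : ℕ) : ℕ := (i + 1) ^ 2 * i.factorial ^ 2 * (sizeSum i + 1)

theorem sizeSum_succ (i : ℕ) : sizeSum (i + 1) = sizeSum i + size i := rfl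

theorem sizeSum_mono : Monotone sizeSum :=
  monotone_nat_of_le_succ fun i => by rw [sizeSum_succ]; omega

theorem size_le_sizeSum {i j : ℕ} (h : i < j) : size i ≤ sizeSum j :=
  le_trans (by rw [sizeSum_succ]; omega) (sizeSum_mono (Nat.succ_le_of_lt h))

theorem size_pos (i : ℕ) : 0 < size i := by unfold size; positivity

/-- The gauge of `ℓ₂`. -/
def gaugeTwo : Gauge where
  adm S c := S.card ≤ 1 ∧ ∀ t ∈ S, c t = 1
  adm_subset S T c h hT := ⟨(Finset.card_le_card h).trans hT.1, fun t ht => hT.2 t (h ht)⟩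
  nonneg S c h t ht := by rw [h.2 t ht]; exact zero_le_one
  le_one S c h t ht := (h.2 t ht).le
  single t := by simp

/-- The gauge of `ℓ₁`. -/
def gaugeOne : Gauge where
  adm S c := ∀ t ∈ S, c t = 1
  adm_subset S T c h hT := fun t ht => hT t (h ht)
  nonneg S c h t ht := by rw [h t ht]; exact zero_le_one
  le_one S c h t ht := (h t ht).le
  single t := by simp

/-- The gauge of the functionals with constant coefficients `theta n` and bounded support. -/
noncomputable def gaugeConst : Gauge where
  adm S c := ∃ n, S.card ≤ size n ∧ ∀ t ∈ S, c t = theta n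
  adm_subset S T c h := fun ⟨n, h1, h2⟩ =>
    ⟨n, (Finset.card_le_card h).trans h1, fun t ht => h2 t (h ht)⟩
  nonneg S c := fun ⟨n, _, h⟩ t ht => by rw [h t ht]; exact (theta_pos n).le
  le_one S c := fun ⟨n, _, h⟩ t ht => by rw [h t ht]; exact theta_le_one n
  single t := ⟨0, by simpa using Nat.succ_le_of_lt (size_pos 0), fun _ _ => theta_zero.symm⟩

/-- The label `l` witnesses that `c` is a sum of boundedly many functionals with constant
coefficients and bounded support. -/
def IsLabel (S : Finset ℕ) (c : ℕ → ℝ) (l : ℕ → ℕ) : Prop :=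
  (∀ t ∈ S, c t = theta (l t)) ∧ (∀ n, (S.filter (l · = n)).card ≤ size n) ∧
    ∀ t ∈ S, (S.image l).card ≤ l t + 1

theorem IsLabel.subset {S T : Finset ℕ} {c : ℕ → ℝ} {l : ℕ → ℕ} (h : IsLabel T c l) (hST : S ⊆ T) :
    IsLabel S c l :=
  ⟨fun t ht => h.1 t (hST ht),
    fun n => (Finset.card_le_card (Finset.filter_subset_filter _ hST)).trans (h.2.1 n),
    fun t ht => (Finset.card_le_card (Finset.image_subset_image hST)).trans (h.2.2 t (hST ht))⟩

theorem isLabel_zero {S : Finset ℕ} {c : ℕ → ℝ} (h : S.card ≤ 1) (hc : ∀ t ∈ S, c t = 1) :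
    IsLabel S c fun _ => 0 := by
  refine ⟨fun t ht => by rw [hc t ht, theta_zero], fun n => ?_, fun t _ => ?_⟩
  · exact (Finset.card_le_card (Finset.filter_subset _ _)).trans (h.trans (size_pos n))
  · exact Finset.card_image_le.trans (h.trans (by omega))

/-- The gauge of the spreading model. -/
noncomputable def gaugeY : Gauge where
  adm S c := ∃ l, IsLabel S c l
  adm_subset S T c h := fun ⟨l, hl⟩ => ⟨l, hl.subset h⟩
  nonneg S c := fun ⟨l, h⟩ t ht => by rw [h.1 t ht]; exact (theta_pos _).le
  le_one S c := fun ⟨l, h⟩ t ht => by rw [h.1 t ht]; exact theta_le_one _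
  single t := ⟨_, isLabel_zero (by simp) fun _ _ => rfl⟩

/-- The gauge of the Schreier-type space. -/
noncomputable def gaugeX : Gauge where
  adm S c := gaugeY.adm S c ∧ ∀ t ∈ S, S.card ≤ t + 1
  adm_subset S T c h hT := ⟨gaugeY.adm_subset S T c h hT.1,
    fun t ht => (Finset.card_le_card h).trans (hT.2 t (h ht))⟩
  nonneg S c h := gaugeY.nonneg S c h.1
  le_one S c h := gaugeY.le_one S c h.1
  single t := ⟨gaugeY.single t, by simp⟩

theorem gaugeX_adm_of_gaugeTwo {S : Finset ℕ} {c : ℕ → ℝ} (h : gaugeTwo.adm S c) :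
    gaugeX.adm S c :=
  ⟨⟨_, isLabel_zero h.1 h.2⟩, fun _ _ => h.1.trans (by omega)⟩

theorem gaugeConst_adm_of_gaugeTwo {S : Finset ℕ} {c : ℕ → ℝ} (h : gaugeTwo.adm S c) :
    gaugeConst.adm S c :=
  ⟨0, h.1.trans (size_pos 0), fun t ht => by rw [h.2 t ht, theta_zero]⟩

theorem gaugeY_adm_of_gaugeConst {S : Finset ℕ} {c : ℕ → ℝ} (h : gaugeConst.adm S c) :
    gaugeY.adm S c := by
  obtain ⟨n, h1, h2⟩ := h
  refine ⟨fun _ => n, h2, fun k => ?_, fun t _ => ?_⟩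
  · by_cases hk : n = k
    · subst hk; simpa using h1
    · simp [hk]
  · exact (Finset.card_le_one.2 (by simp)).trans (by omega)

/-! ### Upper estimates -/

open Gauge

variable {f : ℕ → ℝ} {w : ℝ} {S : Finset ℕ}

theorem pair_le_of_le {a : ℝ} {x : ℕ → ℝ} {p : ℕ} (hx : ∀ t, p ≤ t → x t = 0) (ha : 0 ≤ a)
    (hf : ∀ t ∈ S, f t ≤ a) :
    ∑ t ∈ S, f t * |x t| ≤ a * ∑ t ∈ Finset.range p, |x t| := by
  calc ∑ t ∈ S, f t * |x t| ≤ ∑ t ∈ S, a * |x t| :=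
        Finset.sum_le_sum fun t ht => mul_le_mul_of_nonneg_right (hf t ht) (abs_nonneg _)
    _ ≤ a * ∑ t ∈ Finset.range p, |x t| := by
        rw [← Finset.mul_sum, ← Finset.sum_filter_ne_zero]
        refine mul_le_mul_of_nonneg_left ?_ ha
        refine Finset.sum_le_sum_of_subset_of_nonneg (fun t ht => ?_) fun _ _ _ => abs_nonneg _
        by_contra hp
        exact (Finset.mem_filter.1 ht).2 (by rw [hx t (by simpa using hp), abs_zero])

theorem le_of_comb {adm : Finset ℕ → (ℕ → ℝ) → Prop} {a : ℝ} (ha : 0 ≤ a) (hw : w ≤ 1)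
    (h : Comb adm f w S) (H : ∀ S c, adm S c → ∀ t ∈ S, 0 ≤ c t ∧ c t ≤ a) : ∀ t ∈ S, f t ≤ a := by
  intro t ht
  have h1 := h.sq_le (sq_nonneg a)
    (fun S c hc t ht => pow_le_pow_left₀ (H S c hc t ht).1 (H S c hc t ht).2 2) t ht
  exact le_of_sq_le_sq (by nlinarith [sq_nonneg a]) ha

theorem tendsto_theta : Tendsto theta atTop (𝓝 0) :=
  tendsto_inv_atTop_zero.comp (tendsto_natCast_atTop_atTop.comp factorial_tendsto_atTop)

/-- Far out, the functionals have small coefficients. -/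
theorem exists_theta_mul_le (a : ℝ) {η : ℝ} (hη : 0 < η) :
    ∃ N, theta N * a ≤ η := by
  have h : Tendsto (fun N => theta N * a) atTop (𝓝 0) := by
    simpa using tendsto_theta.mul_const a
  exact ((h.eventually (ge_mem_nhds hη)).exists)

theorem upperStep_gaugeTwo : gaugeTwo.UpperStep fun _ => 0 := by
  intro x p hx η hη
  refine ⟨p, 1, one_pos, fun y hy hyp _ => ?_⟩
  refine nrm_add_le_of_split (mem_of_finite hx) (mem_of_bounded_support hy) fun f w S hw h => ?_
  obtain ⟨w₁, w₂, S₁, S₂, rfl, rfl, hd, hA, hB⟩ := h.split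
    (admA := fun S c => gaugeTwo.adm S c ∧ ∀ t ∈ S, t < p)
    (admB := fun S c => gaugeTwo.adm S c ∧ ∀ t ∈ S, p ≤ t) fun S c h => by
      rcases Finset.card_le_one_iff_subset_singleton.1 h.1 with ⟨a, ha⟩
      rcases lt_or_ge a p with hap | hap
      · exact Or.inl ⟨h, fun t ht => by rw [Finset.mem_singleton.1 (ha ht)]; exact hap⟩
      · exact Or.inr ⟨h, fun t ht => by rw [Finset.mem_singleton.1 (ha ht)]; exact hap⟩
  have hA' := hA.forall_mem fun S c h => h.2
  have hB' := hB.forall_mem fun S c h => h.2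
  refine ⟨w₁, w₂, S₁, S₂, rfl, rfl, hd, hA.imp fun _ _ h => h.1, hB.imp fun _ _ h => h.1, ?_⟩
  rw [Finset.sum_eq_zero fun t ht => by rw [hyp t (hA' t ht), abs_zero, mul_zero],
    Finset.sum_eq_zero fun t ht => by rw [hx t (hB' t ht), abs_zero, mul_zero]]
  linarith

theorem upperStep_gaugeConst : gaugeConst.UpperStep gaugeTwo.nrm := by
  intro x p hx η hη
  obtain ⟨N, hN⟩ := exists_theta_mul_le (∑ t ∈ Finset.range p, |x t|) (half_pos hη)
  refine ⟨0, η / (2 * (√(sizeSum N) + 1)), by positivity, fun y hy _ hyδ => ?_⟩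
  refine nrm_add_le_of_split (mem_of_finite hx) (mem_of_bounded_support hy) fun f w S hw h => ?_
  obtain ⟨w₁, w₂, S₁, S₂, rfl, rfl, hd, hA, hB⟩ := h.split
    (admA := fun S c => ∃ n, n < N ∧ S.card ≤ size n ∧ ∀ t ∈ S, c t = theta n)
    (admB := fun S c => ∃ n, N ≤ n ∧ S.card ≤ size n ∧ ∀ t ∈ S, c t = theta n)
    fun S c ⟨n, h⟩ => (lt_or_ge n N).imp (fun h' => ⟨n, h', h⟩) fun h' => ⟨n, h', h⟩
  have hw1 := hA.weight_nonneg
  have hw2 := hB.weight_nonneg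
  have hA' : Comb gaugeConst.adm f w₁ S₁ := hA.imp fun _ _ ⟨n, _, h⟩ => ⟨n, h⟩
  have hB' : Comb gaugeConst.adm f w₂ S₂ := hB.imp fun _ _ ⟨n, _, h⟩ => ⟨n, h⟩
  refine ⟨w₁, w₂, S₁, S₂, rfl, rfl, hd, hA', hB', ?_⟩
  have b2 : ∑ t ∈ S₂, f t * |x t| ≤ η / 2 := by
    refine (pair_le_of_le hx (theta_pos N).le ?_).trans hN
    refine le_of_comb (theta_pos N).le (by linarith) hB fun S c ⟨n, hn, _, h⟩ t ht => ?_
    rw [h t ht]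
    exact ⟨(theta_pos n).le, theta_anti hn⟩
  have b1 : ∑ t ∈ S₁, f t * |y t| ≤ η / 2 := by
    have q1 : ∑ t ∈ S₁, f t ^ 2 ≤ w₁ * sizeSum N := hA.sum_sq_le fun S c ⟨n, hn, hcard, h⟩ => by
      calc ∑ t ∈ S, c t ^ 2 ≤ ∑ t ∈ S, (1 : ℝ) := Finset.sum_le_sum fun t ht => by
            rw [h t ht]; exact pow_le_one₀ (theta_pos n).le (theta_le_one n)
        _ ≤ sizeSum N := by
            simp only [Finset.sum_const, nsmul_eq_mul, mul_one]
            exact_mod_cast hcard.trans (size_le_sizeSum hn)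
    have q2 : ∑ t ∈ S₁, f t ^ 2 ≤ sizeSum N :=
      q1.trans (mul_le_of_le_one_left (by positivity) (by linarith))
    refine (le_sqrt_mul_nrm (G := gaugeTwo) (mem_of_bounded_support hy)
      (comb_of_nonneg S₁ (comb_nonneg hA'))).trans ?_
    refine (mul_le_mul (Real.sqrt_le_sqrt q2) hyδ nrm_nonneg (Real.sqrt_nonneg _)).trans ?_
    have := Real.sqrt_nonneg (sizeSum N : ℝ)
    rw [mul_div_assoc', div_le_iff₀ (by positivity)]
    nlinarith
  linarith

theorem exists_const_of_label {N : ℕ} {z : ℕ → ℝ}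
    (h : Comb (fun S c => ∃ l, IsLabel S c l ∧ (S.image l).card ≤ N) f w S) :
    ∃ S' ⊆ S, Comb gaugeConst.adm f w S' ∧
      ∑ t ∈ S, f t * |z t| ≤ N * ∑ t ∈ S', f t * |z t| := by
  induction h with
  | empty => exact ⟨∅, subset_rfl, Comb.empty, by simp⟩
  | @base S c a ha h hf =>
    obtain ⟨l, hl, hN⟩ := h
    rcases S.eq_empty_or_nonempty with rfl | hne
    · exact ⟨∅, subset_rfl, Comb.base (c := c) a ha ⟨0, by simp, by simp⟩ (by simp), by simp⟩
    obtain ⟨n, -, hn⟩ := Finset.exists_max_image (S.image l)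
      (fun n => ∑ t ∈ S.filter (l · = n), f t * |z t|) (hne.image l)
    refine ⟨S.filter (l · = n), Finset.filter_subset _ _,
      Comb.base (c := c) a ha ⟨n, hl.2.1 n, fun t ht => ?_⟩
        fun t ht => hf t (Finset.mem_of_mem_filter _ ht), ?_⟩
    · rw [hl.1 t (Finset.mem_of_mem_filter _ ht), (Finset.mem_filter.1 ht).2]
    · rw [← Finset.sum_fiberwise_of_maps_to (g := l) fun t ht => Finset.mem_image_of_mem l ht]
      refine (Finset.sum_le_card_nsmul _ _ _ hn).trans ?_
      rw [nsmul_eq_mul]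
      refine mul_le_mul_of_nonneg_right (by exact_mod_cast hN) (Finset.sum_nonneg fun t ht => ?_)
      have ht := Finset.mem_of_mem_filter _ ht
      rw [hf t ht, hl.1 t ht]
      have := theta_pos (l t)
      positivity
  | union _ _ hd h1 h2 =>
    obtain ⟨T, hT, hc, hle⟩ := h1
    obtain ⟨T', hT', hc', hle'⟩ := h2
    have hd' := hd.mono hT hT'
    refine ⟨T ∪ T', Finset.union_subset_union hT hT', hc.union hc' hd', ?_⟩
    rw [Finset.sum_union hd, Finset.sum_union hd', mul_add]
    exact add_le_add hle hle'

theorem upperStep_gaugeY : gaugeY.UpperStep gaugeConst.nrm := by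
  intro x p hx η hη
  obtain ⟨N, hN⟩ := exists_theta_mul_le (∑ t ∈ Finset.range p, |x t|) (half_pos hη)
  refine ⟨0, η / (2 * (N + 1)), by positivity, fun y hy _ hyδ => ?_⟩
  refine nrm_add_le_of_split (mem_of_finite hx) (mem_of_bounded_support hy) fun f w S hw h => ?_
  obtain ⟨w₁, w₂, S₁, S₂, rfl, rfl, hd, hA, hB⟩ := h.split
    (admA := fun S c => ∃ l, IsLabel S c l ∧ (S.image l).card ≤ N)
    (admB := fun S c => ∃ l, IsLabel S c l ∧ ∀ t ∈ S, N ≤ l t) fun S c ⟨l, h⟩ => by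
      by_cases hl : ∀ t ∈ S, N ≤ l t
      · exact Or.inr ⟨l, h, hl⟩
      · push Not at hl
        obtain ⟨t, ht, hlt⟩ := hl
        exact Or.inl ⟨l, h, (h.2.2 t ht).trans (by omega)⟩
  have hw1 := hA.weight_nonneg
  have hw2 := hB.weight_nonneg
  refine ⟨w₁, w₂, S₁, S₂, rfl, rfl, hd, hA.imp fun _ _ ⟨l, h, _⟩ => ⟨l, h⟩,
    hB.imp fun _ _ ⟨l, h, _⟩ => ⟨l, h⟩, ?_⟩
  have b2 : ∑ t ∈ S₂, f t * |x t| ≤ η / 2 := by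
    refine (pair_le_of_le hx (theta_pos N).le ?_).trans hN
    refine le_of_comb (theta_pos N).le (by linarith) hB fun S c ⟨l, h, hl⟩ t ht => ?_
    rw [h.1 t ht]
    exact ⟨(theta_pos _).le, theta_anti (hl t ht)⟩
  have b1 : ∑ t ∈ S₁, f t * |y t| ≤ η / 2 := by
    obtain ⟨S', -, hc, hle⟩ := exists_const_of_label (z := y) hA
    refine hle.trans ?_
    have := le_nrm (G := gaugeConst) (mem_of_bounded_support hy) (by linarith) hc
    have h2 : (N : ℝ) * ∑ t ∈ S', f t * |y t| ≤ N * (η / (2 * (N + 1))) :=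
      mul_le_mul_of_nonneg_left (this.trans hyδ) (by positivity)
    refine h2.trans ?_
    rw [mul_div_assoc', div_le_iff₀ (by positivity)]
    nlinarith
  linarith

theorem card_le_of_meets {p : ℕ}
    (h : Comb (fun S c => gaugeX.adm S c ∧ ∃ t ∈ S, t < p) f w S) :
    S.card ≤ p * (S.filter (· < p)).card := by
  induction h with
  | empty => simp
  | @base S c a ha h hf =>
    obtain ⟨h, t, ht, htp⟩ := h
    have h1 := h.2 t ht
    have h2 : 0 < (S.filter (· < p)).card :=
      Finset.card_pos.2 ⟨t, Finset.mem_filter.2 ⟨ht, htp⟩⟩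
    nlinarith
  | union _ _ hd h1 h2 =>
    rw [Finset.filter_union, Finset.card_union_of_disjoint hd,
      Finset.card_union_of_disjoint (Finset.disjoint_filter_filter hd), mul_add]
    exact add_le_add h1 h2

/-- Upper estimate for a finite vector followed by a flat vector. -/
theorem nrm_add_le_of_flat {x y : ℕ → ℝ} {p : ℕ} {δ : ℝ} (hx : ∀ t, p ≤ t → x t = 0)
    (hy : gaugeX.Mem y) (hδ : ∀ t, |y t| ≤ δ) :
    gaugeX.nrm (x + y) ≤ √(gaugeX.nrm x ^ 2 + gaugeX.nrm y ^ 2) + p ^ 2 * δ := by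
  refine nrm_add_le_of_split (mem_of_finite hx) hy fun f w S hw h => ?_
  obtain ⟨w₁, w₂, S₁, S₂, rfl, rfl, hd, hA, hB⟩ := h.split
    (admA := fun S c => gaugeX.adm S c ∧ ∃ t ∈ S, t < p)
    (admB := fun S c => gaugeX.adm S c ∧ ∀ t ∈ S, p ≤ t) fun S c h => by
      by_cases hl : ∀ t ∈ S, p ≤ t
      · exact Or.inr ⟨h, hl⟩
      · push Not at hl
        exact Or.inl ⟨h, hl⟩
  have hw1 := hA.weight_nonneg
  have hw2 := hB.weight_nonneg
  have hA' : Comb gaugeX.adm f w₁ S₁ := hA.imp fun _ _ h => h.1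
  have hB' := hB.forall_mem fun S c h => h.2
  refine ⟨w₁, w₂, S₁, S₂, rfl, rfl, hd, hA', hB.imp fun _ _ h => h.1, ?_⟩
  rw [Finset.sum_eq_zero (s := S₂) fun t ht => by rw [hx t (hB' t ht), abs_zero, mul_zero], add_zero]
  have hδ0 : 0 ≤ δ := (abs_nonneg _).trans (hδ 0)
  have h1 : S₁.card ≤ p ^ 2 := by
    have h2 : (S₁.filter (· < p)).card ≤ p := by
      simpa using Finset.card_le_card (show S₁.filter (· < p) ⊆ Finset.range p from
        fun t ht => by simpa using (Finset.mem_filter.1 ht).2)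
    nlinarith [card_le_of_meets hA]
  calc ∑ t ∈ S₁, f t * |y t| ≤ ∑ t ∈ S₁, δ := Finset.sum_le_sum fun t ht => by
        have := comb_le_one (by linarith) hA' t ht
        nlinarith [abs_nonneg (y t), hδ t]
    _ ≤ p ^ 2 * δ := by
        rw [Finset.sum_const, nsmul_eq_mul]
        exact mul_le_mul_of_nonneg_right (by exact_mod_cast h1) hδ0

theorem upperStep_gaugeX : gaugeX.UpperStep gaugeTwo.nrm := by
  intro x p hx η hη
  refine ⟨0, η / (p ^ 2 + 1), by positivity, fun y hy _ hyδ => ?_⟩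
  refine (nrm_add_le_of_flat hx (mem_of_bounded_support hy) fun t =>
    (abs_le_nrm (G := gaugeTwo) (mem_of_bounded_support hy) t).trans hyδ).trans ?_
  gcongr
  rw [mul_div_assoc', div_le_iff₀ (by positivity)]
  nlinarith

theorem small_gaugeTwo : gaugeTwo.Small := fun _ hU hUb hN N _ hε =>
  upperStep_gaugeTwo.exists_nrm_le hU hUb
    (fun N _ hδ => (hN N).imp fun _ h => ⟨h.1, h.2, hδ.le⟩) N hε

theorem small_gaugeX : gaugeX.Small :=
  small_gaugeTwo.of_upperStep (fun _ _ => gaugeX_adm_of_gaugeTwo) (fun _ _ => le_rfl)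
    upperStep_gaugeX

theorem small_gaugeY : gaugeY.Small :=
  (small_gaugeTwo.of_upperStep (fun _ _ => gaugeConst_adm_of_gaugeTwo) (fun _ _ => le_rfl)
    upperStep_gaugeConst).of_upperStep (fun _ _ => gaugeY_adm_of_gaugeConst) (fun _ _ => le_rfl)
    upperStep_gaugeY

/-! ### Extraction of spreading models -/

section SpreadingModel

variable {V : Type*} [NormedAddCommGroup V] [NormedSpace ℝ V]

/-- The iterated limit, along a fixed ultrafilter, of the norms of `x + ∑ b j • v (t j)`. -/
noncomputable def iterLim (v : ℕ → V) : ∀ n : ℕ, V → (Fin n → ℝ) → ℝ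
  | 0, x, _ => ‖x‖
  | n + 1, x, b => lim (Filter.map (fun i => iterLim v n (x + b 0 • v i) (Fin.tail b))
      (Filter.hyperfilter ℕ : Filter ℕ))

theorem exists_tendsto_of_abs_le {ι : Type*} (U : Ultrafilter ι) {a : ι → ℝ} {M : ℝ}
    (h : ∀ i, |a i| ≤ M) : ∃ l, Tendsto a U (𝓝 l) := by
  obtain ⟨l, -, hl⟩ := (isCompact_Icc (a := -M) (b := M)).ultrafilter_le_nhds (U.map a) (by
    rw [Ultrafilter.coe_map, le_principal_iff]
    exact Filter.mem_map.2 (Filter.univ_mem' fun i => abs_le.1 (h i)))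
  exact ⟨l, hl⟩

variable {v : ℕ → V}

theorem iterLim_aux (hv : ∀ i, ‖v i‖ ≤ 1) (n : ℕ) :
    (∀ x b, |iterLim v n x b| ≤ ‖x‖ + ∑ j, |b j|) ∧
    ∀ x b x' b', |iterLim v n x b - iterLim v n x' b'| ≤ ‖x - x'‖ + ∑ j, |b j - b' j| := by
  induction n with
  | zero =>
    refine ⟨fun x b => by simp [iterLim], fun x b x' b' => ?_⟩
    simpa [iterLim] using abs_norm_sub_norm_le x x'
  | succ n ih =>
    have bound : ∀ x (b : Fin (n + 1) → ℝ) i,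
        |iterLim v n (x + b 0 • v i) (Fin.tail b)| ≤ ‖x‖ + ∑ j, |b j| := by
      intro x b i
      refine (ih.1 _ _).trans ?_
      have h1 := norm_add_le x (b 0 • v i)
      rw [norm_smul, Real.norm_eq_abs] at h1
      have h2 := mul_le_of_le_one_right (abs_nonneg (b 0)) (hv i)
      rw [Fin.sum_univ_succ]
      simp only [Fin.tail]
      linarith
    have tends : ∀ x (b : Fin (n + 1) → ℝ),
        Tendsto (fun i => iterLim v n (x + b 0 • v i) (Fin.tail b))
          (Filter.hyperfilter ℕ : Filter ℕ) (𝓝 (iterLim v (n + 1) x b)) := fun x b =>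
      tendsto_nhds_limUnder (exists_tendsto_of_abs_le _ (bound x b))
    refine ⟨fun x b => le_of_tendsto (tends x b).abs (Eventually.of_forall (bound x b)),
      fun x b x' b' => le_of_tendsto ((tends x b).sub (tends x' b')).abs
        (Eventually.of_forall fun i => (ih.2 _ _ _ _).trans ?_)⟩
    have h1 := norm_add_le (x - x') ((b 0 - b' 0) • v i)
    have e1 : x + b 0 • v i - (x' + b' 0 • v i) = x - x' + (b 0 - b' 0) • v i := by
      rw [sub_smul]; abel
    rw [norm_smul, Real.norm_eq_abs, ← e1] at h1
    have h2 := mul_le_of_le_one_right (abs_nonneg (b 0 - b' 0)) (hv i)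
    rw [Fin.sum_univ_succ]
    simp only [Fin.tail]
    linarith

theorem abs_iterLim_sub_le (hv : ∀ i, ‖v i‖ ≤ 1) {n : ℕ} (x : V) (b : Fin n → ℝ) (x' : V)
    (b' : Fin n → ℝ) :
    |iterLim v n x b - iterLim v n x' b'| ≤ ‖x - x'‖ + ∑ j, |b j - b' j| :=
  (iterLim_aux hv n).2 x b x' b'

theorem tendsto_iterLim (hv : ∀ i, ‖v i‖ ≤ 1) {n : ℕ} (x : V) (b : Fin (n + 1) → ℝ) :
    Tendsto (fun i => iterLim v n (x + b 0 • v i) (Fin.tail b))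
      (Filter.hyperfilter ℕ : Filter ℕ) (𝓝 (iterLim v (n + 1) x b)) := by
  refine tendsto_nhds_limUnder
    (exists_tendsto_of_abs_le (M := ‖x‖ + |b 0| + ∑ j, |Fin.tail b j|) _ fun i => ?_)
  refine ((iterLim_aux hv n).1 _ _).trans ?_
  have h1 := norm_add_le x (b 0 • v i)
  rw [norm_smul, Real.norm_eq_abs] at h1
  have h2 := mul_le_of_le_one_right (abs_nonneg (b 0)) (hv i)
  linarith

theorem exists_subseq_tendsto_iterLim [TopologicalSpace.SeparableSpace V] (hv : ∀ i, ‖v i‖ ≤ 1) :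
    ∃ φ : ℕ → ℕ, StrictMono φ ∧ ∀ (n : ℕ) (x : V) (b : Fin (n + 1) → ℝ),
      Tendsto (fun i => iterLim v n (x + b 0 • v (φ i)) (Fin.tail b)) atTop
        (𝓝 (iterLim v (n + 1) x b)) := by
  let D : ∀ n : ℕ, ℕ → V × (Fin (n + 1) → ℝ) := fun n =>
    TopologicalSpace.denseSeq (V × (Fin (n + 1) → ℝ))
  let F : ℕ → ((_ : ℕ) × ℕ) → ℝ := fun i q =>
    iterLim v q.1 ((D q.1 q.2).1 + (D q.1 q.2).2 0 • v i) (Fin.tail (D q.1 q.2).2)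
  have hF : Tendsto F (Filter.hyperfilter ℕ : Filter ℕ)
      (𝓝 fun q => iterLim v (q.1 + 1) (D q.1 q.2).1 (D q.1 q.2).2) :=
    tendsto_pi_nhds.2 fun q => tendsto_iterLim hv _ _
  have hcl : MapClusterPt (fun q : ((_ : ℕ) × ℕ) =>
      iterLim v (q.1 + 1) (D q.1 q.2).1 (D q.1 q.2).2) atTop F :=
    hF.mapClusterPt.mono Nat.hyperfilter_le_atTop
  obtain ⟨φ, hφ, hφF⟩ := hcl.tendsto_subseq
  refine ⟨φ, hφ, fun n x b => ?_⟩
  rw [Metric.tendsto_atTop]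
  intro ε hε
  have hcont : Continuous fun z : V × (Fin (n + 1) → ℝ) => ‖x - z.1‖ + ∑ j, |b j - z.2 j| := by
    fun_prop
  obtain ⟨k, hk⟩ := (TopologicalSpace.denseRange_denseSeq (V × (Fin (n + 1) → ℝ))).exists_mem_open
    (isOpen_lt hcont (continuous_const (y := ε / 3))) ⟨(x, b), by simpa using hε⟩
  change ‖x - (D n k).1‖ + ∑ j, |b j - (D n k).2 j| < ε / 3 at hk
  set x' := (D n k).1 with hx'
  set b' := (D n k).2 with hb'
  have ht : Tendsto (fun i => iterLim v n (x' + b' 0 • v (φ i)) (Fin.tail b')) atTop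
      (𝓝 (iterLim v (n + 1) x' b')) := (tendsto_pi_nhds.1 hφF) ⟨n, k⟩
  obtain ⟨N, hN⟩ := Metric.tendsto_atTop.1 ht (ε / 3) (by positivity)
  refine ⟨N, fun i hi => ?_⟩
  have h1 := hN i hi
  have h2 := abs_iterLim_sub_le hv (n := n + 1) x b x' b'
  have h3 := abs_iterLim_sub_le hv (x + b 0 • v (φ i)) (Fin.tail b) (x' + b' 0 • v (φ i))
    (Fin.tail b')
  have h4 : ‖x + b 0 • v (φ i) - (x' + b' 0 • v (φ i))‖ + ∑ j, |Fin.tail b j - Fin.tail b' j| ≤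
      ‖x - x'‖ + ∑ j, |b j - b' j| := by
    have h1 := norm_add_le (x - x') ((b 0 - b' 0) • v (φ i))
    have e1 : x + b 0 • v (φ i) - (x' + b' 0 • v (φ i)) = x - x' + (b 0 - b' 0) • v (φ i) := by
      rw [sub_smul]; abel
    rw [norm_smul, Real.norm_eq_abs, ← e1] at h1
    have h2 := mul_le_of_le_one_right (abs_nonneg (b 0 - b' 0)) (hv (φ i))
    rw [Fin.sum_univ_succ]
    simp only [Fin.tail]
    linarith
  rw [Real.dist_eq] at h1 ⊢
  rw [abs_lt] at h1 ⊢
  have h2 := abs_le.1 h2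
  have h3 := abs_le.1 h3
  constructor <;> linarith

theorem iteratedLimit_iterLim {φ : ℕ → ℕ}
    (hφ : ∀ (n : ℕ) (x : V) (b : Fin (n + 1) → ℝ),
      Tendsto (fun i => iterLim v n (x + b 0 • v (φ i)) (Fin.tail b)) atTop
        (𝓝 (iterLim v (n + 1) x b))) (n : ℕ) :
    ∀ (x : V) (b : Fin n → ℝ),
      IteratedLimit n (fun t => ‖x + ∑ j, b j • v (φ (t j))‖) (iterLim v n x b) := by
  induction n with
  | zero => intro x b; simp [IteratedLimit, iterLim]
  | succ n ih =>
    intro x b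
    refine ⟨_, fun i₀ => ?_, hφ n x b⟩
    have h := ih (x + b 0 • v (φ i₀)) (Fin.tail b)
    simpa [Fin.sum_univ_succ, Fin.tail, add_assoc] using h

theorem strictMono_cons {n : ℕ} {i : ℕ} {t : Fin n → ℕ} (ht : StrictMono t) (h : ∀ j, i < t j) :
    StrictMono (Fin.cons i t : Fin (n + 1) → ℕ) := by
  intro a b hab
  induction b using Fin.cases with
  | zero => exact absurd hab (Fin.not_lt_zero a)
  | succ b =>
    induction a using Fin.cases with
    | zero => simpa using h b
    | succ a => simpa using ht (Fin.succ_lt_succ_iff.1 hab)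

theorem abs_iterLim_sub_le_of_far (hv : ∀ i, ‖v i‖ ≤ 1) (ℓ ε : ℝ) (n : ℕ) :
    ∀ (x : V) (b : Fin n → ℝ) (m : ℕ),
    (∀ t : Fin n → ℕ, StrictMono t → (∀ j, m ≤ t j) → |‖x + ∑ j, b j • v (t j)‖ - ℓ| ≤ ε) →
    |iterLim v n x b - ℓ| ≤ ε := by
  induction n with
  | zero =>
    intro x b m h
    simpa [iterLim] using h (fun j => j.elim0) (fun j => j.elim0) (fun j => j.elim0)
  | succ n ih =>
    intro x b m h
    refine le_of_tendsto ((tendsto_iterLim hv x b).sub_const ℓ).abs ?_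
    filter_upwards [Nat.hyperfilter_le_atTop (eventually_ge_atTop m)] with i hi
    refine ih _ _ (i + 1) fun t ht hti => ?_
    have := h (Fin.cons i t) (strictMono_cons ht fun j => hti j)
      (Fin.cases (by simpa using hi) fun j => by simpa using hi.trans (by linarith [hti j]))
    simpa [Fin.sum_univ_succ, Fin.tail, add_assoc] using this

/-- If the norms of far-out combinations converge, then a subsequence has all the iterated
limits. -/
theorem exists_subseq_iteratedLimit [TopologicalSpace.SeparableSpace V] (hv : ∀ i, ‖v i‖ ≤ 1)
    (L : ∀ n : ℕ, (Fin n → ℝ) → ℝ)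
    (h : ∀ n (b : Fin n → ℝ), ∀ ε > 0, ∃ m, ∀ t : Fin n → ℕ, StrictMono t → (∀ j, m ≤ t j) →
      |‖∑ j, b j • v (t j)‖ - L n b| ≤ ε) :
    ∃ φ : ℕ → ℕ, StrictMono φ ∧ ∀ n (b : Fin n → ℝ),
      IteratedLimit n (fun t => ‖∑ j, b j • v (φ (t j))‖) (L n b) := by
  obtain ⟨φ, hφ, hφt⟩ := exists_subseq_tendsto_iterLim hv
  refine ⟨φ, hφ, fun n b => ?_⟩
  have e : iterLim v n 0 b = L n b := by
    refine eq_of_abs_sub_nonpos (le_of_forall_pos_le_add fun ε hε => ?_)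
    obtain ⟨m, hm⟩ := h n b ε hε
    rw [zero_add]
    exact abs_iterLim_sub_le_of_far hv _ ε n 0 b m (by simpa using hm)
  rw [← e]
  simpa using iteratedLimit_iterLim hφt n 0 b

end SpreadingModel

/-! ### The two spreading models -/

theorem IsLabel.image {T : Finset ℕ} {c c' : ℕ → ℝ} {l σ : ℕ → ℕ} (h : IsLabel T c l)
    (hσ : Set.InjOn σ T) (hc : ∀ t ∈ T, c' (σ t) = c t) : ∃ l', IsLabel (T.image σ) c' l' := by
  set l' : ℕ → ℕ := fun s => l (Function.invFunOn σ T s) with hl'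
  have e : ∀ t ∈ T, l' (σ t) = l t := fun t ht => by rw [hl']; simp only [hσ.leftInvOn_invFunOn ht]
  have e2 : (T.image σ).image l' = T.image l := by
    rw [Finset.image_image]
    exact Finset.image_congr fun t ht => e t ht
  refine ⟨l', ?_, fun n => ?_, ?_⟩
  · simp only [Finset.forall_mem_image]
    intro t ht
    rw [hc t ht, e t ht, h.1 t ht]
  · rw [Finset.filter_image, Finset.filter_congr fun t ht => by rw [e t ht]]
    exact Finset.card_image_le.trans (h.2.1 n)
  · simp only [Finset.forall_mem_image]
    intro t ht
    rw [e2, e t ht]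
    exact h.2.2 t ht

namespace Sp

variable {G : Gauge}

theorem val_sum_e_comp {n : ℕ} (b : Fin n → ℝ) {t : Fin n → ℕ} (ht : Function.Injective t) :
    val (∑ j, b j • e G (t j)) = Function.extend t b 0 := by
  ext s
  rw [map_sum, Finset.sum_apply]
  by_cases h : ∃ j, t j = s
  · obtain ⟨j, rfl⟩ := h
    rw [ht.extend_apply, Finset.sum_eq_single_of_mem j (Finset.mem_univ j) fun k _ hk => ?_]
    · simp
    · simp [ht.ne hk.symm]
  · rw [Function.extend_apply' _ _ _ h, Finset.sum_eq_zero fun j _ => ?_]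
    · rfl
    · have : s ≠ t j := fun hs => h ⟨j, hs.symm⟩
      simp [this]

end Sp

open Sp

theorem norm_sum_e_eq {n : ℕ} (b : Fin n → ℝ) {t : Fin n → ℕ} (ht : StrictMono t)
    (hn : ∀ j, n ≤ t j) : ‖∑ j, b j • e gaugeX (t j)‖ = ‖∑ j : Fin n, b j • e gaugeY j‖ := by
  have hi := ht.injective
  have hv := Fin.val_injective (n := n)
  set σ : ℕ → ℕ := Function.extend t Fin.val 0 with hσ
  set τ : ℕ → ℕ := Function.extend Fin.val t 0 with hτ
  have eσ : ∀ j, σ (t j) = j := fun j => hi.extend_apply _ _ j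
  have eτ : ∀ j : Fin n, τ j = t j := fun j => hv.extend_apply _ _ j
  apply le_antisymm
  · refine Gauge.nrm_le_of_image (S₀ := Set.range t) (σ := σ) (mem _) ?_ ?_ ?_ ?_
    · rintro _ ⟨i, rfl⟩ _ ⟨j, rfl⟩ h
      rw [eσ, eσ] at h
      rw [Fin.ext h]
    · intro s hs
      rw [val_sum_e_comp b hi, Function.extend_apply' _ _ _ hs]
      rfl
    · rintro _ ⟨j, rfl⟩
      rw [eσ, val_sum_e_comp b hi, val_sum_e_comp b hv, hi.extend_apply, hv.extend_apply]
    · rintro T c c' hT ⟨⟨l, hl⟩, -⟩ hc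
      refine hl.image ?_ hc
      intro x hx y hy h
      obtain ⟨i, rfl⟩ := hT hx
      obtain ⟨j, rfl⟩ := hT hy
      rw [eσ, eσ] at h
      rw [Fin.ext h]
  · refine Gauge.nrm_le_of_image (S₀ := Set.range (Fin.val : Fin n → ℕ)) (σ := τ) (mem _) ?_ ?_ ?_ ?_
    · rintro _ ⟨i, rfl⟩ _ ⟨j, rfl⟩ h
      rw [eτ, eτ] at h
      rw [hi h]
    · intro s hs
      rw [val_sum_e_comp b hv, Function.extend_apply' _ _ _ hs]
      rfl
    · rintro _ ⟨j, rfl⟩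
      rw [eτ, val_sum_e_comp b hi, val_sum_e_comp b hv, hi.extend_apply, hv.extend_apply]
    · rintro T c c' hT ⟨l, hl⟩ hc
      refine ⟨hl.image ?_ hc, ?_⟩
      · intro x hx y hy h
        obtain ⟨i, rfl⟩ := hT hx
        obtain ⟨j, rfl⟩ := hT hy
        rw [eτ, eτ] at h
        rw [hi h]
      · simp only [Finset.forall_mem_image]
        intro s hs
        obtain ⟨j, rfl⟩ := hT hs
        rw [eτ]
        have h1 : T.card ≤ n := by
          simpa using Finset.card_le_card (show T ⊆ Finset.range n from fun s hs => by
            obtain ⟨j, rfl⟩ := hT hs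
            simp)
        exact Finset.card_image_le.trans (h1.trans ((hn j).trans (by omega)))

theorem sum_range_smul_eq {V : Type*} [NormedAddCommGroup V] [NormedSpace ℝ V] (n : ℕ) (b : ℕ → ℝ)
    (v : ℕ → V) : ∑ j ∈ Finset.range n, b j • v j = ∑ j : Fin n, b j • v j :=
  (Fin.sum_univ_eq_sum_range (fun j => b j • v j) n).symm

/-- A strictly increasing sequence of unit vectors, or of normalized disjoint vectors, is
normalized and basic. -/
theorem normalized_basic_of_disjoint {G : Gauge} {v : ℕ → Sp G} (hv : Normalized v)
    (hd : ∀ i j t, i ≠ j → val (v i) t = 0 ∨ val (v j) t = 0) {φ : ℕ → ℕ} (hφ : StrictMono φ) :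
    Normalized (v ∘ φ) ∧ ∃ C, IsCBasic C (v ∘ φ) :=
  ⟨fun i => hv _, 1, isCBasic_of_disjoint
    (fun i h => by
      have := hv (φ i)
      rw [show v (φ i) = 0 from h, norm_zero] at this
      exact zero_ne_one this)
    fun i j t hij => hd _ _ _ (hφ.injective.ne hij)⟩

theorem e_disjoint {G : Gauge} (i j t : ℕ) (hij : i ≠ j) :
    val (e G i) t = 0 ∨ val (e G j) t = 0 := by
  by_cases h : t = i
  · right; subst h; simp [hij]
  · left; simp [h]

theorem exists_spreadingModel_X : ∃ x : ℕ → Sp gaugeX, (Normalized x ∧ ∃ C, IsCBasic C x) ∧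
    IsSpreadingModelOf x (e gaugeY) := by
  obtain ⟨φ, hφ, h⟩ := exists_subseq_iteratedLimit (v := e gaugeX) (fun i => (norm_e i).le)
    (fun n b => ‖∑ j : Fin n, b j • e gaugeY j‖) fun n b ε hε =>
      ⟨n, fun t ht hn => by rw [norm_sum_e_eq b ht hn, sub_self, abs_zero]; exact hε.le⟩
  refine ⟨_, normalized_basic_of_disjoint norm_e e_disjoint hφ, fun n b => ?_⟩
  rw [sum_range_smul_eq]
  exact h n fun j => b j

theorem norm_sum_e_gaugeOne (n : ℕ) (c : ℕ → ℝ) :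
    ‖∑ i ∈ Finset.range n, c i • e gaugeOne i‖ = ∑ i ∈ Finset.range n, |c i| := by
  set x := ∑ i ∈ Finset.range n, c i • e gaugeOne i with hx
  have hval : ∀ t, val x t = if t < n then c t else 0 := val_sum_e c
  have e1 : ∑ i ∈ Finset.range n, |val x i| = ∑ i ∈ Finset.range n, |c i| :=
    Finset.sum_congr rfl fun i hi => by rw [hval, if_pos (Finset.mem_range.1 hi)]
  rw [← e1]
  refine le_antisymm (Gauge.nrm_le_sum_abs fun t ht => by rw [hval, if_neg (by omega)]) ?_
  have hc : Comb gaugeOne.adm (fun _ => 1) (1 ^ 2) (Finset.range n) :=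
    Comb.base (c := fun _ => 1) 1 zero_le_one (fun _ _ => rfl) (by simp)
  simpa using le_norm x (by norm_num) hc

theorem equivToL1Basis_e : EquivToL1Basis (e gaugeOne) :=
  ⟨1, 1, one_pos, one_pos, fun n c => by simp [norm_sum_e_gaugeOne]⟩

/-! ### Blocks spanning `ℓ₁` -/

theorem sizeSum_eq (i : ℕ) : sizeSum i = ∑ n ∈ Finset.range i, size n := by
  induction i with
  | zero => rfl
  | succ i ih => rw [sizeSum_succ, Finset.sum_range_succ, ih]

/-- The support of the `i`-th block. -/
def blockSet (i : ℕ) : Finset ℕ := (Finset.range (size i)).image (Nat.pair i)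

theorem card_blockSet (i : ℕ) : (blockSet i).card = size i := by
  rw [blockSet, Finset.card_image_of_injective _ fun a b h => (Nat.pair_eq_pair.1 h).2,
    Finset.card_range]

theorem unpair_of_mem_blockSet {i s : ℕ} (h : s ∈ blockSet i) : s.unpair.1 = i := by
  obtain ⟨k, -, rfl⟩ := Finset.mem_image.1 h
  simp

theorem disjoint_blockSet {i j : ℕ} (h : i ≠ j) : Disjoint (blockSet i) (blockSet j) :=
  Finset.disjoint_left.2 fun _ hs hs' =>
    h ((unpair_of_mem_blockSet hs).symm.trans (unpair_of_mem_blockSet hs'))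

theorem Comb.sq_sum_le {adm : Finset ℕ → (ℕ → ℝ) → Prop} {f : ℕ → ℝ} {w D : ℝ} {S : Finset ℕ}
    (h : Comb adm f w S) (A : Finset ℕ) (hD : 0 ≤ D)
    (H : ∀ S c, adm S c → (∑ t ∈ S ∩ A, c t) ^ 2 ≤ (S ∩ A).card * D) :
    (∑ t ∈ S ∩ A, f t) ^ 2 ≤ w * ((S ∩ A).card * D) := by
  induction h with
  | empty => simp
  | @base S c a ha h hf =>
    rw [Finset.sum_congr rfl fun t ht => hf t (Finset.mem_inter.1 ht).1, ← Finset.mul_sum, mul_pow]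
    exact mul_le_mul_of_nonneg_left (H _ _ h) (by positivity)
  | @union w w' S S' h h' hd h1 h2 =>
    have hd' : Disjoint (S ∩ A) (S' ∩ A) :=
      hd.mono Finset.inter_subset_left Finset.inter_subset_left
    rw [Finset.union_inter_distrib_right, Finset.sum_union hd', Finset.card_union_of_disjoint hd']
    set s := ∑ t ∈ S ∩ A, f t
    set s' := ∑ t ∈ S' ∩ A, f t
    push_cast
    set k : ℝ := ((S ∩ A).card : ℝ) with hk
    set k' : ℝ := ((S' ∩ A).card : ℝ) with hk'
    have k0 : 0 ≤ k := by positivity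
    have k0' : 0 ≤ k' := by positivity
    have w0 := h.weight_nonneg
    have w0' := h'.weight_nonneg
    have hp : 2 * (s * s') ≤ w * (k' * D) + w' * (k * D) := by
      refine le_trans (le_abs_self _) (abs_le_of_sq_le_sq ?_ (by positivity))
      have := mul_le_mul h1 h2 (sq_nonneg _) (by positivity)
      nlinarith [sq_nonneg (w * (k' * D) - w' * (k * D))]
    nlinarith

theorem sum_label_le {S A : Finset ℕ} {c : ℕ → ℝ} {l : ℕ → ℕ} (h : IsLabel S c l) {i : ℕ}
    (hA : A.card ≤ size i) :
    (∑ t ∈ S ∩ A, c t) ^ 2 ≤ (S ∩ A).card * (√(sizeSum i) + theta i * √(size i)) ^ 2 := by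
  set B := S ∩ A
  have hB : ∀ t ∈ B, t ∈ S := fun t ht => (Finset.mem_inter.1 ht).1
  have h1 : ∑ t ∈ B, c t ≤ (B.filter (l · < i)).card + theta i * B.card := by
    calc ∑ t ∈ B, c t ≤ ∑ t ∈ B, ((if l t < i then 1 else 0) + theta i) := by
          refine Finset.sum_le_sum fun t ht => ?_
          rw [h.1 t (hB t ht)]
          split_ifs with hl
          · linarith [theta_le_one (l t), theta_pos i]
          · linarith [theta_anti (not_lt.1 hl)]
      _ = _ := by
          rw [Finset.sum_add_distrib, Finset.sum_const, nsmul_eq_mul, Finset.sum_boole, mul_comm]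
  have h2 : (B.filter (l · < i)).card ≤ sizeSum i := by
    rw [sizeSum_eq, Finset.card_eq_sum_card_fiberwise (f := l) (t := Finset.range i)
      fun t ht => by simpa using (Finset.mem_filter.1 ht).2]
    refine Finset.sum_le_sum fun n _ => le_trans (Finset.card_le_card fun t ht => ?_) (h.2.1 n)
    simp only [Finset.mem_filter] at ht ⊢
    exact ⟨hB t ht.1.1, ht.2⟩
  have h3 : (B.filter (l · < i)).card ≤ B.card := Finset.card_filter_le _ _
  have h4 : B.card ≤ size i := (Finset.card_le_card Finset.inter_subset_right).trans hA
  have le_sqrt : ∀ a b d : ℕ, a ≤ b → a ≤ d → (a : ℝ) ≤ √b * √d := fun a b d hb hd => by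
    rw [← Real.sqrt_mul (by positivity)]
    refine Real.le_sqrt_of_sq_le ?_
    have : a ^ 2 ≤ b * d := by nlinarith
    exact_mod_cast this
  have q1 := le_sqrt _ _ _ h3 h2
  have q2 := le_sqrt _ _ _ le_rfl h4
  have q3 := mul_le_mul_of_nonneg_left q2 (theta_pos i).le
  have h5 : ∑ t ∈ B, c t ≤ √B.card * (√(sizeSum i) + theta i * √(size i)) := by
    nlinarith
  have h0 : 0 ≤ ∑ t ∈ B, c t := Finset.sum_nonneg fun t ht => by
    rw [h.1 t (hB t ht)]; exact (theta_pos _).le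
  have h6 := pow_le_pow_left₀ h0 h5 2
  rwa [mul_pow, Real.sq_sqrt (by positivity)] at h6

theorem sqrt_sizeSum_le (i : ℕ) : √(sizeSum i) ≤ theta i * √(size i) / (i + 1) := by
  have h : (sizeSum i : ℝ) ≤ (theta i * √(size i) / (i + 1)) ^ 2 := by
    rw [div_pow, mul_pow, Real.sq_sqrt (by positivity), theta, size]
    have : (0 : ℝ) < i.factorial := by positivity
    push_cast
    field_simp
    linarith
  rw [← Real.sqrt_sq (show 0 ≤ theta i * √(size i) / (i + 1) from by
    have := theta_pos i; positivity)]
  exact Real.sqrt_le_sqrt h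

/-- The blocks, before normalization. -/
noncomputable def block (i : ℕ) : Sp gaugeY :=
  mk ((blockSet i : Set ℕ).indicator fun _ => (theta i * size i)⁻¹)
    (Gauge.mem_of_finite (p := (blockSet i).sup id + 1) fun t ht =>
      Set.indicator_of_notMem (fun h => by
        have := Finset.le_sup (f := id) (Finset.mem_coe.1 h)
        simp only [id] at this
        omega) _)

theorem val_block_of_mem {i s : ℕ} (h : s ∈ blockSet i) :
    val (block i) s = (theta i * size i)⁻¹ := by
  rw [block, val_mk, Set.indicator_of_mem (Finset.mem_coe.2 h)]

theorem val_block_of_notMem {i s : ℕ} (h : s ∉ blockSet i) : val (block i) s = 0 := by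
  rw [block, val_mk, Set.indicator_of_notMem (mt Finset.mem_coe.1 h)]

theorem norm_block_le (i : ℕ) : ‖block i‖ ≤ 1 + 1 / (i + 1) := by
  refine norm_le fun f w S hw hc => ?_
  have hm : (0 : ℝ) < size i := by exact_mod_cast size_pos i
  have hθ := theta_pos i
  have hf := Gauge.comb_nonneg hc
  have e1 : ∑ t ∈ S, f t * |val (block i) t| =
      (theta i * size i)⁻¹ * ∑ t ∈ S ∩ blockSet i, f t := by
    rw [Finset.mul_sum, ← Finset.sum_subset (Finset.inter_subset_left (s₂ := blockSet i))]
    · refine Finset.sum_congr rfl fun t ht => ?_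
      rw [val_block_of_mem (Finset.mem_inter.1 ht).2, abs_of_nonneg (by positivity), mul_comm]
    · intro t ht ht'
      rw [val_block_of_notMem fun h => ht' (Finset.mem_inter.2 ⟨ht, h⟩), abs_zero, mul_zero]
  have h1 := hc.sq_sum_le (blockSet i) (D := (√(sizeSum i) + theta i * √(size i)) ^ 2)
    (sq_nonneg _) fun S c ⟨l, hl⟩ => sum_label_le hl (card_blockSet i).le
  have h2 : ((S ∩ blockSet i).card : ℝ) ≤ size i := by
    exact_mod_cast (Finset.card_le_card Finset.inter_subset_right).trans (card_blockSet i).le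
  set s := ∑ t ∈ S ∩ blockSet i, f t
  have hs0 := Real.sqrt_nonneg (size i : ℝ)
  have hs := Real.sq_sqrt hm.le
  have hp0 := Real.sqrt_nonneg (sizeSum i : ℝ)
  have h3 : s ≤ √(size i) * (√(sizeSum i) + theta i * √(size i)) := by
    refine le_of_sq_le_sq (h1.trans ?_) (by positivity)
    rw [mul_pow, hs]
    have hD := sq_nonneg (√(sizeSum i) + theta i * √(size i))
    have := mul_le_mul_of_nonneg_right h2 hD
    have h0 : 0 ≤ ((S ∩ blockSet i).card : ℝ) * (√(sizeSum i) + theta i * √(size i)) ^ 2 := by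
      positivity
    nlinarith [hc.weight_nonneg]
  have h4 : s ≤ theta i * size i * (1 + 1 / (i + 1)) := by
    have h5 := mul_le_mul_of_nonneg_left (sqrt_sizeSum_le i) hs0
    have h6 : √(size i) * (theta i * √(size i) / (i + 1)) = theta i * size i * (1 / (i + 1)) := by
      rw [← hs, Real.sqrt_sq hs0]; ring
    have h7 : √(size i) * (theta i * √(size i)) = theta i * size i := by
      rw [← hs, Real.sqrt_sq hs0]; ring
    rw [h6] at h5
    rw [mul_add, h7] at h3
    linarith
  rw [e1, inv_mul_le_iff₀ (by positivity)]
  exact h4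

theorem sum_abs_le_norm_sum_block {n : ℕ} (a : Fin n → ℝ) {t : Fin n → ℕ} (ht : StrictMono t)
    (hn : ∀ j, n ≤ t j) : ∑ j, |a j| ≤ ‖∑ j, a j • block (t j)‖ := by
  set S := Finset.univ.biUnion fun j => blockSet (t j) with hS
  have hmem : ∀ s ∈ S, s ∈ blockSet s.unpair.1 ∧ ∃ j, s.unpair.1 = t j := fun s hs => by
    obtain ⟨j, -, hj⟩ := Finset.mem_biUnion.1 hs
    rw [unpair_of_mem_blockSet hj]
    exact ⟨hj, j, rfl⟩
  have hadm : gaugeY.adm S fun s => theta s.unpair.1 := by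
    refine ⟨fun s => s.unpair.1, fun _ _ => rfl, fun k => ?_, fun s hs => ?_⟩
    · rw [← card_blockSet k]
      refine Finset.card_le_card fun s hs => ?_
      have h' := Finset.mem_filter.1 hs
      have := (hmem s h'.1).1
      rwa [show s.unpair.1 = k from h'.2] at this
    · obtain ⟨j, hj⟩ := (hmem s hs).2
      have : S.image (fun s => s.unpair.1) ⊆ Finset.univ.image t := by
        intro k hk
        obtain ⟨s, hs, rfl⟩ := Finset.mem_image.1 hk
        obtain ⟨j, hj⟩ := (hmem s hs).2
        exact Finset.mem_image.2 ⟨j, Finset.mem_univ j, hj.symm⟩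
      have h1 := (Finset.card_le_card this).trans Finset.card_image_le
      rw [Finset.card_univ, Fintype.card_fin] at h1
      have h2 := hn j
      rw [← hj] at h2
      exact (h1.trans h2).trans (Nat.le_succ _)
  have hc := Comb.base (f := fun s => theta s.unpair.1) 1 zero_le_one hadm (by simp)
  refine le_trans (le_of_eq ?_) (le_norm _ (by norm_num) hc)
  rw [hS, Finset.sum_biUnion fun i _ j _ hij => disjoint_blockSet (ht.injective.ne hij)]
  refine Finset.sum_congr rfl fun j _ => ?_
  have hθ := theta_pos (t j)
  have hm : (0 : ℝ) < size (t j) := by exact_mod_cast size_pos (t j)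
  rw [Finset.sum_congr rfl (g := fun _ => |a j| * (size (t j) : ℝ)⁻¹) fun s hs => ?_]
  · rw [Finset.sum_const, card_blockSet, nsmul_eq_mul]
    field_simp
  · rw [unpair_of_mem_blockSet hs, map_sum, Finset.sum_apply,
      Finset.sum_eq_single_of_mem j (Finset.mem_univ j) fun k _ hk => ?_]
    · rw [map_smul, Pi.smul_apply, smul_eq_mul, val_block_of_mem hs, abs_mul,
        abs_of_nonneg (a := (theta (t j) * size (t j))⁻¹) (by positivity)]
      field_simp
    · have : s ∉ blockSet (t k) := Finset.disjoint_left.1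
        (disjoint_blockSet (ht.injective.ne hk.symm)) hs
      simp [val_block_of_notMem this]

theorem one_le_norm_block (i : ℕ) : 1 ≤ ‖block i‖ := by
  have hθ := theta_pos i
  have hm : (0 : ℝ) < size i := by exact_mod_cast size_pos i
  have hadm : gaugeY.adm (blockSet i) fun _ => theta i :=
    gaugeY_adm_of_gaugeConst ⟨i, (card_blockSet i).le, fun _ _ => rfl⟩
  have hc := Comb.base (f := fun _ => theta i) 1 zero_le_one hadm (by simp)
  refine le_trans (le_of_eq ?_) (le_norm _ (by norm_num) hc)
  rw [Finset.sum_congr rfl (g := fun _ => (size i : ℝ)⁻¹) fun s hs => ?_]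
  · rw [Finset.sum_const, card_blockSet, nsmul_eq_mul, mul_inv_cancel₀ hm.ne']
  · rw [val_block_of_mem hs, abs_of_nonneg (by positivity)]
    field_simp

/-- The normalized blocks. -/
noncomputable def nblock (i : ℕ) : Sp gaugeY := ‖block i‖⁻¹ • block i

theorem normalized_nblock : Normalized nblock := fun i => by
  have : ‖block i‖ ≠ 0 := (zero_lt_one.trans_le (one_le_norm_block i)).ne'
  rw [nblock, norm_smul, norm_inv, norm_norm, inv_mul_cancel₀ this]

theorem nblock_disjoint (i j s : ℕ) (hij : i ≠ j) :
    val (nblock i) s = 0 ∨ val (nblock j) s = 0 := by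
  by_cases h : s ∈ blockSet i
  · right
    simp [nblock, val_block_of_notMem (Finset.disjoint_left.1 (disjoint_blockSet hij) h)]
  · left
    simp [nblock, val_block_of_notMem h]

theorem exists_spreadingModel_Y : ∃ y : ℕ → Sp gaugeY, (Normalized y ∧ ∃ C, IsCBasic C y) ∧
    IsSpreadingModelOf y (e gaugeOne) := by
  obtain ⟨φ, hφ, h⟩ := exists_subseq_iteratedLimit (v := nblock) (fun i => (normalized_nblock i).le)
    (fun n b => ∑ j, |b j|) fun n b ε hε => by
      obtain ⟨m, hm⟩ := exists_nat_gt ((∑ j, |b j|) / ε)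
      refine ⟨max n m, fun t ht htm => ?_⟩
      have up : ‖∑ j, b j • nblock (t j)‖ ≤ ∑ j, |b j| := by
        refine (norm_sum_le _ _).trans (le_of_eq (Finset.sum_congr rfl fun j _ => ?_))
        rw [norm_smul, normalized_nblock, mul_one, Real.norm_eq_abs]
      have lo := sum_abs_le_norm_sum_block (fun j => b j * ‖block (t j)‖⁻¹) ht
        fun j => (le_max_left n m).trans (htm j)
      simp only [mul_smul] at lo
      have lo2 : (∑ j, |b j|) - (∑ j, |b j|) / (m + 1) ≤ ∑ j, |b j * ‖block (t j)‖⁻¹| := by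
        rw [Finset.sum_div, ← Finset.sum_sub_distrib]
        refine Finset.sum_le_sum fun j _ => ?_
        have h1 := one_le_norm_block (t j)
        have h2 := norm_block_le (t j)
        have h3 : (m : ℝ) ≤ t j := by exact_mod_cast (le_max_right n m).trans (htm j)
        have h4 : (1 : ℝ) / (t j + 1) ≤ 1 / (m + 1) := by gcongr
        rw [abs_mul, abs_inv, abs_norm, ← mul_one_div, ← mul_one_sub]
        refine mul_le_mul_of_nonneg_left ?_ (abs_nonneg _)
        rw [← one_div, le_div_iff₀ (by linarith)]
        have h5 : (1 : ℝ) / (m + 1) ≤ 1 := by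
          rw [div_le_one (by positivity)]; linarith [Nat.cast_nonneg (α := ℝ) m]
        nlinarith [show (0 : ℝ) ≤ 1 / (m + 1) by positivity]
      have lo3 : (∑ j, |b j|) / (m + 1) ≤ ε := by
        rw [div_lt_iff₀ hε] at hm
        rw [div_le_iff₀ (by positivity)]
        nlinarith
      change _ ≤ ‖∑ j, b j • nblock (t j)‖ at lo
      rw [abs_le]
      constructor <;> linarith
  refine ⟨_, normalized_basic_of_disjoint normalized_nblock nblock_disjoint hφ, fun n b => ?_⟩
  rw [norm_sum_e_gaugeOne, ← Fin.sum_univ_eq_sum_range (fun i => |b i|) n]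
  exact h n fun j => b j

/-! ### Weak limits in reflexive spaces -/

section WeakLimit

variable {V : Type*} [NormedAddCommGroup V] [NormedSpace ℝ V]

theorem IsReflexive.exists_weak_limit (hV : IsReflexive V) (U : Ultrafilter ℕ) {v : ℕ → V} {M : ℝ}
    (hv : ∀ i, ‖v i‖ ≤ M) :
    ∃ x, ∀ g : StrongDual ℝ V, Tendsto (fun i => g (v i)) U (𝓝 (g x)) := by
  have bound : ∀ (g : StrongDual ℝ V) i, |g (v i)| ≤ M * ‖g‖ := fun g i => by
    rw [← Real.norm_eq_abs, mul_comm]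
    exact (g.le_opNorm _).trans (mul_le_mul_of_nonneg_left (hv i) (norm_nonneg _))
  choose l hl using fun g : StrongDual ℝ V => exists_tendsto_of_abs_le U (bound g)
  let Φ : StrongDual ℝ V →ₗ[ℝ] ℝ :=
    { toFun := l
      map_add' := fun g h => tendsto_nhds_unique (hl (g + h)) ((hl g).add (hl h))
      map_smul' := fun c g => tendsto_nhds_unique (hl (c • g)) ((hl g).const_mul c) }
  obtain ⟨x, hx⟩ := hV (Φ.mkContinuous M fun g =>
    le_of_tendsto (hl g).norm (Eventually.of_forall fun i => bound g i))
  refine ⟨x, fun g => ?_⟩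
  have : g x = l g := congrArg (fun F : StrongDual ℝ (StrongDual ℝ V) => F g) hx
  rw [this]
  exact hl g

/-- The convex combinations of indices that are at least `N`. -/
def convexTail (N : ℕ) : Set (ℕ →₀ ℝ) :=
  {a | (∀ j, 0 ≤ a j) ∧ (∀ j < N, a j = 0) ∧ Finsupp.linearCombination ℝ (fun _ => (1 : ℝ)) a = 1}

theorem convex_convexTail (N : ℕ) : Convex ℝ (convexTail N) := by
  rintro a ⟨h1, h2, h3⟩ a' ⟨h1', h2', h3'⟩ s t hs ht hst
  refine ⟨fun j => ?_, fun j hj => ?_, ?_⟩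
  · simpa using add_nonneg (mul_nonneg hs (h1 j)) (mul_nonneg ht (h1' j))
  · simp [h2 j hj, h2' j hj]
  · rw [map_add, map_smul, map_smul, h3, h3']
    simpa using hst

theorem mem_closure_convexTail {U : Ultrafilter ℕ} (hU : (U : Filter ℕ) ≤ atTop) {v : ℕ → V} {x : V}
    (hx : ∀ g : StrongDual ℝ V, Tendsto (fun i => g (v i)) U (𝓝 (g x))) (N : ℕ) {ε : ℝ}
    (hε : 0 < ε) : ∃ a ∈ convexTail N, ‖x - Finsupp.linearCombination ℝ v a‖ < ε := by
  have hc : x ∈ closure (Finsupp.linearCombination ℝ v '' convexTail N) := by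
    by_contra hn
    obtain ⟨g, u, h1, h2⟩ := geometric_hahn_banach_point_closed
      ((convex_convexTail N).linear_image (Finsupp.linearCombination ℝ v)).closure
      isClosed_closure hn
    refine absurd (ge_of_tendsto (hx g) ?_) (not_le.2 h1)
    filter_upwards [hU (eventually_ge_atTop N)] with i hi
    refine (h2 _ (subset_closure ⟨Finsupp.single i 1, ⟨fun j => ?_, fun j hj => ?_, ?_⟩, ?_⟩)).le
    · rw [Finsupp.single_apply]; split_ifs <;> norm_num
    · rw [Finsupp.single_apply, if_neg (by omega)]
    · simp
    · simp
  obtain ⟨_, ⟨a, ha, rfl⟩, h⟩ := Metric.mem_closure_iff.1 hc ε hε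
  exact ⟨a, ha, by rwa [← dist_eq_norm]⟩

theorem exists_support_subset (a : ℕ →₀ ℝ) : ∃ n, a.support ⊆ Finset.range n :=
  ⟨a.support.sup id + 1, fun j hj => by
    have := Finset.le_sup (f := id) hj
    simp only [id] at this
    exact Finset.mem_range.2 (by omega)⟩

theorem linearCombination_eq_sum_range {v : ℕ → V} {a : ℕ →₀ ℝ} {n : ℕ}
    (h : a.support ⊆ Finset.range n) :
    Finsupp.linearCombination ℝ v a = ∑ j ∈ Finset.range n, a j • v j :=
  Finsupp.sum_of_support_subset _ h _ fun _ _ => zero_smul _ _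

/-- A normalized basic sequence in a reflexive space is weakly null. -/
theorem IsReflexive.tendsto_zero_of_basic (hV : IsReflexive V) {U : Ultrafilter ℕ}
    (hU : (U : Filter ℕ) ≤ atTop) {v : ℕ → V} (hv : Normalized v) {C : ℝ} (hC : IsCBasic C v)
    (g : StrongDual ℝ V) : Tendsto (fun i => g (v i)) U (𝓝 0) := by
  obtain ⟨x, hx⟩ := hV.exists_weak_limit U fun i => (hv i).le
  suffices x = 0 by simpa [this] using hx g
  have hC0 : 0 ≤ C := by
    have := hC.2 1 2 (by norm_num) (fun i => if i = 0 then 1 else 0)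
    simp [hv 0] at this
    linarith
  rw [← norm_le_zero_iff]
  refine le_of_forall_pos_le_add fun ε hε => ?_
  rw [zero_add]
  set δ := ε / (2 * C + 1) with hδ
  have hδ0 : 0 < δ := by positivity
  obtain ⟨a, -, ha⟩ := mem_closure_convexTail hU hx 0 hδ0
  obtain ⟨n, hn⟩ := exists_support_subset a
  obtain ⟨a', ⟨-, ha0, -⟩, ha'⟩ := mem_closure_convexTail hU hx n hδ0
  obtain ⟨m, hm⟩ := exists_support_subset a'
  have hb := hC.2 n (max (n + 1) m) (by omega) fun i => (a - a') i
  have e1 : ∑ i ∈ Finset.range n, (a - a') i • v i = Finsupp.linearCombination ℝ v a := by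
    rw [linearCombination_eq_sum_range hn]
    exact Finset.sum_congr rfl fun i hi => by
      simp [ha0 i (Finset.mem_range.1 hi)]
  have e2 : ∑ i ∈ Finset.range (max (n + 1) m), (a - a') i • v i =
      Finsupp.linearCombination ℝ v a - Finsupp.linearCombination ℝ v a' := by
    rw [← map_sub, linearCombination_eq_sum_range]
    refine (Finsupp.support_sub).trans (Finset.union_subset (hn.trans ?_) (hm.trans ?_)) <;>
      exact Finset.range_subset_range.2 (by omega)
  rw [e1, e2] at hb
  have t1 := norm_add_le (x - Finsupp.linearCombination ℝ v a) (Finsupp.linearCombination ℝ v a)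
  rw [sub_add_cancel] at t1
  have t2 := norm_sub_le (x - Finsupp.linearCombination ℝ v a') (x - Finsupp.linearCombination ℝ v a)
  rw [sub_sub_sub_cancel_left] at t2
  have t3 : ‖x‖ ≤ δ * (2 * C + 1) := by nlinarith
  rwa [hδ, div_mul_cancel₀ _ (by positivity)] at t3

/-- A bounded sequence in a reflexive space has small combinations with coefficients of unit
`ℓ₁`-norm. -/
theorem IsReflexive.exists_norm_sum_le (hV : IsReflexive V) {v : ℕ → V} {M : ℝ}
    (hv : ∀ i, ‖v i‖ ≤ M) {ε : ℝ} (hε : 0 < ε) :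
    ∃ (n : ℕ) (b : ℕ → ℝ), ∑ j ∈ Finset.range n, |b j| = 1 ∧
      ‖∑ j ∈ Finset.range n, b j • v j‖ ≤ ε := by
  have hU := Nat.hyperfilter_le_atTop
  obtain ⟨x, hx⟩ := hV.exists_weak_limit (Filter.hyperfilter ℕ) hv
  obtain ⟨a, ⟨ha1, -, ha2⟩, ha⟩ := mem_closure_convexTail hU hx 0 hε
  obtain ⟨n, hn⟩ := exists_support_subset a
  obtain ⟨a', ⟨ha1', ha0', ha2'⟩, ha'⟩ := mem_closure_convexTail hU hx n hε
  obtain ⟨m, hm⟩ := exists_support_subset a'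
  have hn' := hn.trans (Finset.range_subset_range.2 (le_max_left n m))
  have hm' := hm.trans (Finset.range_subset_range.2 (le_max_right n m))
  rw [linearCombination_eq_sum_range hn'] at ha ha2
  rw [linearCombination_eq_sum_range hm'] at ha' ha2'
  refine ⟨max n m, fun j => (a j - a' j) / 2, ?_, ?_⟩
  · rw [Finset.sum_congr rfl (g := fun j => (a j • (1 : ℝ) + a' j • (1 : ℝ)) / 2) fun j _ => ?_]
    · rw [← Finset.sum_div, Finset.sum_add_distrib, ha2, ha2']
      norm_num
    · rw [abs_div, abs_two, smul_eq_mul, smul_eq_mul, mul_one, mul_one]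
      by_cases hj : j < n
      · rw [ha0' j hj, sub_zero, add_zero, abs_of_nonneg (ha1 j)]
      · have : a j = 0 := by
          by_contra h
          exact hj (Finset.mem_range.1 (hn (Finsupp.mem_support_iff.2 h)))
        rw [this, zero_sub, zero_add, abs_neg, abs_of_nonneg (ha1' j)]
  · have e1 : ∑ j ∈ Finset.range (max n m), ((a j - a' j) / 2) • v j = (1 / 2 : ℝ) •
        (∑ j ∈ Finset.range (max n m), a j • v j - ∑ j ∈ Finset.range (max n m), a' j • v j) := by
      rw [← Finset.sum_sub_distrib, Finset.smul_sum]
      exact Finset.sum_congr rfl fun j _ => by rw [← sub_smul, smul_smul]; congr 1; ring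
    rw [e1, norm_smul]
    have t2 := norm_sub_le (x - ∑ j ∈ Finset.range (max n m), a' j • v j)
      (x - ∑ j ∈ Finset.range (max n m), a j • v j)
    rw [sub_sub_sub_cancel_left] at t2
    norm_num
    linarith

end WeakLimit

/-! ### Decreasing rearrangements -/

theorem exists_max_notMem {y : ℕ → ℝ} (hy : Tendsto y atTop (𝓝 0)) (A : Finset ℕ) :
    ∃ t ∉ A, ∀ s ∉ A, |y s| ≤ |y t| := by
  by_cases h : ∃ s ∉ A, y s ≠ 0
  · obtain ⟨s, hs, hs0⟩ := h
    obtain ⟨p, hp⟩ := eventually_atTop.1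
      (hy.abs.eventually (gt_mem_nhds (by simpa using abs_pos.2 hs0 : |(0 : ℝ)| < |y s|)))
    obtain ⟨t, ht, hmax⟩ := Finset.exists_max_image ((Finset.range p ∪ {s}) \ A) (|y ·|)
      ⟨s, by simp [hs]⟩
    refine ⟨t, (Finset.mem_sdiff.1 ht).2, fun r hr => ?_⟩
    by_cases hrp : r < p
    · exact hmax r (by simp [hrp, hr])
    · exact (hp r (not_lt.1 hrp)).le.trans (hmax s (by simp [hs]))
  · push Not at h
    obtain ⟨t, ht⟩ := Infinite.exists_notMem_finset A
    exact ⟨t, ht, fun s hs => by rw [h s hs, h t ht]⟩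

/-- An injective enumeration of coordinates in decreasing order of modulus. -/
theorem exists_rearrangement {y : ℕ → ℝ} (hy : Tendsto y atTop (𝓝 0)) :
    ∃ π : ℕ → ℕ, Function.Injective π ∧
      ∀ r, ∀ t ∉ (Finset.range r).image π, |y t| ≤ |y (π r)| := by
  choose m hm hmax using exists_max_notMem hy
  let A : ℕ → Finset ℕ := Nat.rec ∅ fun _ A => insert (m A) A
  have hA : ∀ r, A r = (Finset.range r).image fun r => m (A r) := fun r => by
    induction r with
    | zero => rfl
    | succ r ih =>
      rw [Finset.range_add_one, Finset.image_insert, ← ih]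
  refine ⟨fun r => m (A r), ?_, fun r t ht => hmax _ _ (by rwa [hA r])⟩
  refine Function.Injective.of_lt_imp_ne fun r s hrs h => hm (A s) ?_
  rw [← h, hA s]
  exact Finset.mem_image_of_mem _ (Finset.mem_range.2 hrs)

namespace Gauge

variable {G : Gauge}

theorem nrm_le_sum_abs_of_support {x : ℕ → ℝ} (A : Finset ℕ) (hx : ∀ t ∉ A, x t = 0) :
    G.nrm x ≤ ∑ t ∈ A, |x t| :=
  nrm_le fun f w S hw h => by
    calc ∑ t ∈ S, f t * |x t| ≤ ∑ t ∈ S, |x t| :=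
          Finset.sum_le_sum fun t ht => by
            nlinarith [comb_le_one hw h t ht, abs_nonneg (x t)]
      _ ≤ ∑ t ∈ A, |x t| := by
          rw [← Finset.sum_filter_ne_zero]
          refine Finset.sum_le_sum_of_subset_of_nonneg (fun t ht => ?_) fun _ _ _ => abs_nonneg _
          by_contra hp
          exact (Finset.mem_filter.1 ht).2 (by rw [hx t hp, abs_zero])

end Gauge

/-- Off the `R` largest coordinates, a vector is flat. -/
theorem abs_le_of_rearrangement {G : Gauge} {y : ℕ → ℝ} (hy : G.Mem y) (hy1 : G.nrm y ≤ 1)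
    {π : ℕ → ℕ} (hπ : Function.Injective π)
    (hmax : ∀ r, ∀ t ∉ (Finset.range r).image π, |y t| ≤ |y (π r)|) (R : ℕ) {t : ℕ}
    (ht : t ∉ (Finset.range R).image π) : |y t| ≤ 1 / √(R + 1) := by
  have h1 := sum_sq_le_nrm_sq hy ((Finset.range (R + 1)).image π)
  rw [Finset.sum_image hπ.injOn] at h1
  have h2 : ∑ r ∈ Finset.range (R + 1), y t ^ 2 ≤ ∑ r ∈ Finset.range (R + 1), y (π r) ^ 2 := by
    refine Finset.sum_le_sum fun r hr => sq_le_sq.2 (hmax r t fun h => ht ?_)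
    refine Finset.image_subset_image (Finset.range_subset_range.2 ?_) h
    have := Finset.mem_range.1 hr
    omega
  rw [Finset.sum_const, Finset.card_range, nsmul_eq_mul] at h2
  have h3 : G.nrm y ^ 2 ≤ 1 := pow_le_one₀ nrm_nonneg hy1
  have hR : (0 : ℝ) < R + 1 := by positivity
  rw [le_div_iff₀ (Real.sqrt_pos.2 hR)]
  refine abs_le_of_sq_le_sq' ?_ zero_le_one |>.2
  rw [mul_pow, Real.sq_sqrt hR.le, sq_abs]
  push_cast at h2
  linarith

/-- The limit of the decreasing rearrangements of vectors of `Sp gaugeX` with null coordinates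
belongs to the unit ball of `Sp gaugeY`, wherever it is placed. -/
theorem pair_le_of_tendsto_rearrangement {U : Ultrafilter ℕ} {y : ℕ → Sp gaugeX}
    (hy : ∀ i, ‖y i‖ ≤ 1) (hy0 : ∀ t, Tendsto (fun i => val (y i) t) U (𝓝 0))
    {π : ℕ → ℕ → ℕ} (hπ : ∀ i, Function.Injective (π i)) {w : ℕ → ℝ}
    (hw : ∀ r, Tendsto (fun i => val (y i) (π i r)) U (𝓝 (w r))) {u : ℕ → ℝ} {ρ : ℕ → ℕ}
    (hρ : Set.InjOn ρ {s | u s ≠ 0}) (hu : ∀ s, u s ≠ 0 → u s = w (ρ s)) {f : ℕ → ℝ} {v : ℝ}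
    {S : Finset ℕ} (hv : v ≤ 1) (hc : Comb gaugeY.adm f v S) : ∑ s ∈ S, f s * |u s| ≤ 1 := by
  classical
  set S' := S.filter (u · ≠ 0) with hS'
  have e1 : ∑ s ∈ S, f s * |u s| = ∑ s ∈ S', f s * |u s| := by
    refine (Finset.sum_subset (Finset.filter_subset _ _) fun s hs hs' => ?_).symm
    have : u s = 0 := by
      by_contra h
      exact hs' (Finset.mem_filter.2 ⟨hs, h⟩)
    rw [this, abs_zero, mul_zero]
  have hne : ∀ s ∈ S', u s ≠ 0 := fun s hs => (Finset.mem_filter.1 hs).2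
  rw [e1]
  let z : ℕ → ℕ → ℝ := fun i s => if s ∈ S' then val (y i) (π i (ρ s)) else 0
  have hzt : ∀ s, Tendsto (fun i => z i s) U (𝓝 (if s ∈ S' then u s else 0)) := fun s => by
    by_cases hs : s ∈ S'
    · simp only [z, if_pos hs]
      rw [hu s (hne s hs)]
      exact hw _
    · simp only [z, if_neg hs]
      exact tendsto_const_nhds
  have hfar : ∀ s ∈ S', ∀ᶠ i in (U : Filter ℕ), S'.card ≤ π i (ρ s) + 1 := fun s hs => by
    have h1 : ∀ᶠ i in (U : Filter ℕ), ∀ t ∈ Finset.range S'.card, |val (y i) t| < |u s| / 2 := by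
      rw [Filter.eventually_all_finset]
      intro t _
      refine (hy0 t).abs.eventually (gt_mem_nhds ?_)
      simpa using hne s hs
    have h2 : ∀ᶠ i in (U : Filter ℕ), |u s| / 2 < |val (y i) (π i (ρ s))| := by
      refine (hw (ρ s)).abs.eventually (lt_mem_nhds ?_)
      rw [← hu s (hne s hs)]
      exact half_lt_self (abs_pos.2 (hne s hs))
    filter_upwards [h1, h2] with i h1 h2
    by_contra! hlt
    exact absurd (h1 _ (Finset.mem_range.2 (by omega))) (not_lt.2 h2.le)
  have hM : ∀ᶠ i in (U : Filter ℕ), gaugeY.Mem (z i) ∧ gaugeY.nrm (z i) ≤ 1 := by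
    filter_upwards [(Filter.eventually_all_finset S').2 hfar] with i hi
    have hinj : Set.InjOn (fun s => π i (ρ s)) S' := fun s hs s' hs' h =>
      hρ (hne s hs) (hne s' hs') (hπ i h)
    refine ⟨mem_of_bounded_support ⟨S'.sup id + 1, fun s hs => if_neg fun h => ?_⟩, ?_⟩
    · have := Finset.le_sup (f := id) h
      simp only [id] at this
      omega
    refine le_trans (nrm_le_of_image (G' := gaugeX) (S₀ := S') (mem (y i)) hinj
      (fun s hs => if_neg hs) (fun s hs => by simp only [z]; rw [if_pos (Finset.mem_coe.1 hs)])
      ?_) (hy i)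
    rintro T c c' hT ⟨l, hl⟩ hcc
    refine ⟨hl.image (hinj.mono hT) hcc, Finset.forall_mem_image.2 fun s hs => ?_⟩
    exact Finset.card_image_le.trans ((Finset.card_le_card (Finset.coe_subset.1 hT)).trans
      (hi s (hT hs)))
  have := pair_le_of_tendsto hzt hM hv (comb_subset hc (Finset.filter_subset (u · ≠ 0) S))
  refine le_trans (le_of_eq (Finset.sum_congr rfl fun s hs => ?_)) this
  rw [if_pos hs]

/-! ### Asymptotic models of `Sp gaugeX` -/

/-- Decomposition of a vector into a finite vector that follows the prescribed values `w` on its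
largest coordinates, a flat vector and a small error. -/
theorem exists_decomposition {y : Sp gaugeX} (hy : ‖y‖ ≤ 1) {π : ℕ → ℕ}
    (hπ : Function.Injective π)
    (hmax : ∀ r, ∀ t ∉ (Finset.range r).image π, |val y t| ≤ |val y (π r)|) (R p : ℕ)
    {w : ℕ → ℝ} {δ : ℝ}
    (hδ : ∑ t ∈ Finset.range p, |val y t| + ∑ r ∈ Finset.range R, |val y (π r) - w r| < δ) :
    ∃ (q : ℕ) (W V : ℕ → ℝ) (ρ : ℕ → ℕ), p ≤ q ∧ (∀ t, t < p ∨ q ≤ t → W t = 0 ∧ V t = 0) ∧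
      gaugeX.nrm (val y - (W + V)) ≤ δ ∧ gaugeX.nrm V ≤ 1 ∧ (∀ t, |V t| ≤ 1 / √(R + 1)) ∧
      (∀ t, W t ≠ 0 → W t = w (ρ t)) ∧ Set.InjOn ρ {t | W t ≠ 0} := by
  obtain ⟨q, hq, hpq⟩ := (((tendsto_iff_norm_sub_tendsto_zero.1 (tendsto_restrict y)).eventually
    (gt_mem_nhds (sub_pos.2 hδ))).and (eventually_ge_atTop p)).exists
  set A := (Finset.range R).image π with hA
  set ρ := Function.invFun π
  have hρ : ∀ r, ρ (π r) = r := Function.leftInverse_invFun hπ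
  set W : ℕ → ℝ := fun t => if (p ≤ t ∧ t < q) ∧ t ∈ A then w (ρ t) else 0 with hW
  set V : ℕ → ℝ := fun t => if (p ≤ t ∧ t < q) ∧ t ∉ A then val y t else 0 with hV
  refine ⟨q, W, V, ρ, hpq, fun t ht => ?_, ?_, ?_, fun t => ?_, fun t ht => ?_, ?_⟩
  · have : ¬ (p ≤ t ∧ t < q) := by omega
    simp [hW, hV, this]
  · set E₁ : ℕ → ℝ := fun t => if t < p then val y t else 0 with hE₁
    set E₂ : ℕ → ℝ := fun t => if (p ≤ t ∧ t < q) ∧ t ∈ A then val y t - w (ρ t) else 0 with hE₂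
    have e : val y - (W + V) = E₁ + E₂ + val (y - restrict (Set.Iio q) y) := by
      ext t
      simp only [Pi.sub_apply, Pi.add_apply, map_sub, val_restrict, hW, hV, hE₁, hE₂]
      by_cases h1 : t < p
      · simp [h1, not_le.2 h1, h1.trans_le hpq]
      · by_cases h2 : t < q
        · by_cases h3 : t ∈ A <;> simp [h1, h2, h3, not_lt.1 h1]
        · simp [h1, h2]
    have n1 : gaugeX.nrm E₁ ≤ ∑ t ∈ Finset.range p, |val y t| := by
      refine (nrm_le_sum_abs_of_support (Finset.range p) fun t ht => ?_).trans
        (Finset.sum_le_sum fun t ht => ?_)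
      · exact if_neg (by simpa using ht)
      · simp only [hE₁]
        split_ifs <;> simp
    have n2 : gaugeX.nrm E₂ ≤ ∑ r ∈ Finset.range R, |val y (π r) - w r| := by
      refine (nrm_le_sum_abs_of_support A fun t ht => ?_).trans ?_
      · exact if_neg fun h => ht h.2
      · rw [hA, Finset.sum_image hπ.injOn]
        refine Finset.sum_le_sum fun r _ => ?_
        simp only [hE₂, hρ]
        split_ifs <;> simp
    have m1 : gaugeX.Mem E₁ := mem_of_finite (p := p) fun t ht => if_neg (not_lt.2 ht)
    have m2 : gaugeX.Mem E₂ := mem_of_finite (p := q) fun t ht => if_neg fun h => by omega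
    have t1 := nrm_add_le (Gauge.mem_add m1 m2) (Sp.mem (y - restrict (Set.Iio q) y))
    have t2 := nrm_add_le m1 m2
    rw [← norm_def, norm_sub_rev] at t1
    rw [e]
    linarith
  · refine (nrm_mono (Sp.mem y) fun t => ?_).trans hy
    simp only [hV]
    split_ifs <;> simp
  · simp only [hV]
    split_ifs with h
    · exact abs_le_of_rearrangement (Sp.mem y) hy hπ hmax R h.2
    · rw [abs_zero]; positivity
  · simp only [hW] at ht ⊢
    split_ifs at ht ⊢
    · rfl
    · exact absurd rfl ht
  · have hmem : ∀ t, W t ≠ 0 → ∃ r, π r = t := fun t ht => by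
      by_contra h
      refine ht (if_neg fun h' => h ?_)
      obtain ⟨r, -, hr⟩ := Finset.mem_image.1 h'.2
      exact ⟨r, hr⟩
    intro t ht t' ht' h
    obtain ⟨r, rfl⟩ := hmem t ht
    obtain ⟨r', rfl⟩ := hmem t' ht'
    rw [hρ, hρ] at h
    rw [h]

/-- Up to an error `η`, the vector `s` is the sum of a vector dominated by a rearrangement of the
first `j` rows of `x` and of a vector of norm at most `√Q`. -/
def IsApproxSplit (x : ℕ → ℝ) (j : ℕ) (Q η : ℝ) (s : Sp gaugeX) : Prop :=
  ∃ (p : ℕ) (W V : ℕ → ℝ) (τ : ℕ → ℕ), (∀ t, p ≤ t → W t = 0 ∧ V t = 0) ∧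
    gaugeX.nrm (val s - (W + V)) ≤ η ∧ gaugeX.nrm V ≤ √Q + η ∧
    (∀ t, W t ≠ 0 → |W t| ≤ |x (τ t)| ∧ (τ t).unpair.1 < j) ∧ Set.InjOn τ {t | W t ≠ 0}

theorem isApproxSplit_zero (x : ℕ → ℝ) : IsApproxSplit x 0 0 0 0 := by
  have h0 : gaugeX.nrm 0 ≤ 0 := by
    simpa using nrm_le_sum_abs (G := gaugeX) (x := 0) (p := 0) fun _ _ => rfl
  refine ⟨0, 0, 0, id, fun _ _ => ⟨rfl, rfl⟩, ?_, ?_, fun t ht => absurd rfl ht,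
    fun t ht => absurd rfl ht⟩
  · simpa using h0
  · simpa using h0

theorem IsApproxSplit.norm_le {x : ℕ → ℝ} (hx : gaugeY.Mem x) {j : ℕ} {Q η : ℝ} {s : Sp gaugeX}
    (h : IsApproxSplit x j Q η s) : ‖s‖ ≤ gaugeY.nrm x + √Q + 2 * η := by
  obtain ⟨p, W, V, τ, hp, hs, hV, hW, hτ⟩ := h
  have mW : gaugeX.Mem W := mem_of_finite fun t ht => (hp t ht).1
  have mV : gaugeX.Mem V := mem_of_finite fun t ht => (hp t ht).2
  have mWV := Gauge.mem_add mW mV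
  have nW : gaugeX.nrm W ≤ gaugeY.nrm x :=
    nrm_le_of_image hx hτ (fun t ht => not_not.1 ht) (fun t ht => (hW t ht).1)
      fun T c c' hT hadm hc => hadm.1.choose_spec.image (hτ.mono hT) hc
  have t1 := nrm_add_le (gaugeX.space.sub_mem (Sp.mem s) mWV) mWV
  rw [sub_add_cancel, ← norm_def] at t1
  have t2 := nrm_add_le mW mV
  linarith

theorem sqrt_add_sq_le {Q η b : ℝ} (hQ : 0 ≤ Q) (hη : 0 ≤ η) :
    √((√Q + η) ^ 2 + b ^ 2) ≤ √(Q + b ^ 2) + η := by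
  refine Real.sqrt_le_iff.2 ⟨by positivity, ?_⟩
  have h1 := Real.sq_sqrt hQ
  have h2 := Real.sq_sqrt (show 0 ≤ Q + b ^ 2 by positivity)
  have h3 : √Q ≤ √(Q + b ^ 2) := Real.sqrt_le_sqrt (by nlinarith)
  nlinarith

theorem IsApproxSplit.step {U : Ultrafilter ℕ} {y : ℕ → Sp gaugeX} (hy : ∀ i, ‖y i‖ ≤ 1)
    (hy0 : ∀ t, Tendsto (fun i => val (y i) t) U (𝓝 0)) {π : ℕ → ℕ → ℕ}
    (hπ : ∀ i, Function.Injective (π i))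
    (hmax : ∀ i r, ∀ t ∉ (Finset.range r).image (π i), |val (y i) t| ≤ |val (y i) (π i r)|)
    {w : ℕ → ℝ} (hw : ∀ r, Tendsto (fun i => val (y i) (π i r)) U (𝓝 (w r)))
    {x : ℕ → ℝ} {j : ℕ} {b : ℝ} (hx : ∀ r, x (Nat.pair j (r + 1)) = b * w r)
    {Q η κ : ℝ} (hQ : 0 ≤ Q) (hκ : 0 < κ) {s : Sp gaugeX} (hs : IsApproxSplit x j Q η s) :
    ∀ᶠ i in (U : Filter ℕ), IsApproxSplit x (j + 1) (Q + b ^ 2) (η + κ) (s + b • y i) := by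
  obtain ⟨p, W, V, τ, hp, hs, hV, hW, hτ⟩ := hs
  have hη : 0 ≤ η := nrm_nonneg.trans hs
  set δ := κ / (|b| + 1) with hδ
  have hδ0 : 0 < δ := by positivity
  have hbδ : |b| * δ ≤ κ := by
    rw [hδ, mul_div_assoc', div_le_iff₀ (by positivity)]
    nlinarith
  obtain ⟨R, hR⟩ := exists_nat_gt ((p ^ 2 * |b| / κ) ^ 2)
  have hflat : (p : ℝ) ^ 2 * (|b| * (1 / √(R + 1))) ≤ κ := by
    have h1 : p ^ 2 * |b| / κ ≤ √(R + 1) := Real.le_sqrt_of_sq_le (by linarith)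
    rw [← mul_assoc, mul_one_div, div_le_iff₀ (Real.sqrt_pos.2 (by positivity))]
    rwa [div_le_iff₀' hκ] at h1
  have hsmall : Tendsto (fun i => ∑ t ∈ Finset.range p, |val (y i) t| +
      ∑ r ∈ Finset.range R, |val (y i) (π i r) - w r|) U (𝓝 0) := by
    have h1 := tendsto_finsetSum (Finset.range p) fun t _ => (hy0 t).abs
    have h2 := tendsto_finsetSum (Finset.range R) fun r _ => ((hw r).sub_const (w r)).abs
    simpa using h1.add h2
  filter_upwards [hsmall.eventually (gt_mem_nhds hδ0)] with i hi
  obtain ⟨q, W', V', ρ, hpq, hq, hs', hV', hflat', hW', hρ⟩ :=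
    exists_decomposition (hy i) (hπ i) (hmax i) R p hi
  have mW : gaugeX.Mem W := mem_of_finite fun t ht => (hp t ht).1
  have mV : gaugeX.Mem V := mem_of_finite fun t ht => (hp t ht).2
  have mW' : gaugeX.Mem W' := mem_of_finite (p := q) fun t ht => (hq t (Or.inr ht)).1
  have mV' : gaugeX.Mem V' := mem_of_finite (p := q) fun t ht => (hq t (Or.inr ht)).2
  have cases : ∀ t, (W + b • W') t ≠ 0 → (t < p ∧ W t ≠ 0 ∧ (W + b • W') t = W t) ∨
      (¬ t < p ∧ W' t ≠ 0 ∧ (W + b • W') t = b * W' t) := fun t ht => by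
    simp only [Pi.add_apply, Pi.smul_apply, smul_eq_mul] at ht ⊢
    by_cases h : t < p
    · left
      rw [(hq t (Or.inl h)).1, mul_zero, add_zero] at ht ⊢
      exact ⟨h, ht, rfl⟩
    · right
      rw [(hp t (not_lt.1 h)).1, zero_add] at ht ⊢
      exact ⟨h, right_ne_zero_of_mul ht, rfl⟩
  refine ⟨q, W + b • W', V + b • V', fun t => if t < p then τ t else Nat.pair j (ρ t + 1),
    fun t ht => ?_, ?_, ?_, fun t ht => ?_, ?_⟩
  · simp [hp t (hpq.trans ht), hq t (Or.inr ht)]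
  · have e : val (s + b • y i) - (W + b • W' + (V + b • V')) =
        (val s - (W + V)) + b • (val (y i) - (W' + V')) := by
      rw [map_add, map_smul]
      module
    have m1 := gaugeX.space.sub_mem (Sp.mem s) (Gauge.mem_add mW mV)
    have m2 := gaugeX.space.sub_mem (Sp.mem (y i)) (Gauge.mem_add mW' mV')
    rw [e]
    refine (nrm_add_le m1 (Gauge.mem_smul m2 b)).trans ?_
    rw [Gauge.nrm_smul m2]
    have := mul_le_mul_of_nonneg_left hs' (abs_nonneg b)
    linarith
  · refine (nrm_add_le_of_flat (δ := |b| * (1 / √(R + 1))) (fun t ht => (hp t ht).2)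
      (Gauge.mem_smul mV' b) fun t => ?_).trans ?_
    · rw [Pi.smul_apply, smul_eq_mul, abs_mul]
      exact mul_le_mul_of_nonneg_left (hflat' t) (abs_nonneg b)
    · have h1 : gaugeX.nrm (b • V') ^ 2 ≤ b ^ 2 := by
        rw [Gauge.nrm_smul mV', mul_pow, sq_abs]
        exact mul_le_of_le_one_right (sq_nonneg b) (pow_le_one₀ nrm_nonneg hV')
      have h2 := pow_le_pow_left₀ nrm_nonneg hV 2
      have h3 := Real.sqrt_le_sqrt (add_le_add h2 h1)
      have h4 := sqrt_add_sq_le (b := b) hQ hη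
      linarith
  · beta_reduce
    rcases cases t ht with ⟨h, hne, e⟩ | ⟨h, hne, e⟩
    · rw [e, if_pos h]
      exact ⟨(hW t hne).1, (hW t hne).2.trans (Nat.lt_succ_self j)⟩
    · rw [e, if_neg h, hx, ← hW' t hne, Nat.unpair_pair]
      exact ⟨le_rfl, Nat.lt_succ_self j⟩
  · intro t ht t' ht' htt
    dsimp only at htt
    rcases cases t ht with ⟨h, hne, -⟩ | ⟨h, hne, -⟩ <;>
      rcases cases t' ht' with ⟨h', hne', -⟩ | ⟨h', hne', -⟩
    · rw [if_pos h, if_pos h'] at htt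
      exact hτ hne hne' htt
    · rw [if_pos h, if_neg h'] at htt
      have := (hW t hne).2
      rw [htt, Nat.unpair_pair] at this
      exact absurd this (lt_irrefl j)
    · rw [if_neg h, if_pos h'] at htt
      have := (hW t' hne').2
      rw [← htt, Nat.unpair_pair] at this
      exact absurd this (lt_irrefl j)
    · rw [if_neg h, if_neg h', Nat.pair_eq_pair] at htt
      exact hρ hne hne' (by omega)

/-- Upper bound for iterated limits. -/
theorem iteratedLimit_le {U : Ultrafilter ℕ} (hU : (U : Filter ℕ) ≤ atTop)
    {y : ℕ → ℕ → Sp gaugeX} {x b : ℕ → ℝ} (hx : gaugeY.Mem x) {N : ℕ}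
    (hstep : ∀ j < N, ∀ Q η κ s, 0 ≤ Q → 0 < κ → IsApproxSplit x j Q η s →
      ∀ᶠ i in (U : Filter ℕ), IsApproxSplit x (j + 1) (Q + b j ^ 2) (η + κ) (s + b j • y j i))
    (n : ℕ) : ∀ (j : ℕ) (Q η : ℝ) (s : Sp gaugeX) (L : ℝ), j + n ≤ N → 0 ≤ Q →
      IsApproxSplit x j Q η s →
      IteratedLimit n (fun t => ‖s + ∑ k : Fin n, b (j + k) • y (j + k) (t k)‖) L →
      L ≤ gaugeY.nrm x + √(Q + ∑ k : Fin n, b (j + k) ^ 2) + 2 * η := by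
  induction n with
  | zero =>
    intro j Q η s L _ _ hs hL
    have : ‖s‖ = L := by simpa [IteratedLimit] using hL
    rw [← this]
    simpa using hs.norm_le hx
  | succ n ih =>
    intro j Q η s L hj hQ hs hL
    obtain ⟨g, hg, hgL⟩ := hL
    refine le_of_forall_pos_le_add fun κ hκ => ?_
    refine le_of_tendsto (hgL.mono_left hU) ?_
    filter_upwards [hstep j (by omega) Q η (κ / 2) s hQ (by positivity) hs] with i hi
    have hidx : ∀ k : Fin n, j + ((k : ℕ) + 1) = j + 1 + k := fun k => by omega
    have := ih (j + 1) _ _ _ (g i) (by omega) (by positivity) hi (by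
      convert hg i using 3 with t
      rw [Fin.sum_univ_succ, ← add_assoc]
      simp only [Fin.cons_zero, Fin.cons_succ, Fin.val_zero, Fin.val_succ, add_zero, hidx])
    rw [Fin.sum_univ_succ]
    simp only [Fin.val_zero, add_zero, Fin.val_succ, hidx]
    rw [← add_assoc]
    linarith

/-- The model row attached to an array: the unit vector at `(j, 0)` together with the values `w`
placed at `(j, 1), (j, 2), …`. -/
theorem exists_modelRow {U : Ultrafilter ℕ} {y : ℕ → Sp gaugeX} (hy : ∀ i, ‖y i‖ ≤ 1)
    (hy0 : ∀ t, Tendsto (fun i => val (y i) t) U (𝓝 0)) {π : ℕ → ℕ → ℕ}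
    (hπ : ∀ i, Function.Injective (π i)) {w : ℕ → ℝ}
    (hw : ∀ r, Tendsto (fun i => val (y i) (π i r)) U (𝓝 (w r))) (j : ℕ) :
    ∃ p : Sp gaugeY, ‖p‖ ≤ 2 ∧ val p (Nat.pair j 0) = 1 ∧
      (∀ r, val p (Nat.pair j (r + 1)) = w r) ∧ ∀ k r, k ≠ j → val p (Nat.pair k r) = 0 := by
  set u : ℕ → ℝ := fun s =>
    if s.unpair.1 = j ∧ s.unpair.2 ≠ 0 then w (s.unpair.2 - 1) else 0 with hu
  have hne : ∀ s, u s ≠ 0 → s.unpair.1 = j ∧ s.unpair.2 ≠ 0 := fun s hs => by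
    by_contra h
    exact hs (if_neg h)
  have hρ : Set.InjOn (fun s : ℕ => s.unpair.2 - 1) {s | u s ≠ 0} := fun s hs s' hs' h => by
    have h1 := hne s hs
    have h2 := hne s' hs'
    dsimp only at h
    rw [← Nat.pair_unpair s, ← Nat.pair_unpair s', h1.1, h2.1, Nat.pair_eq_pair]
    exact ⟨rfl, by omega⟩
  have hpair : ∀ f v S, v ≤ 1 → Comb gaugeY.adm f v S → ∑ s ∈ S, f s * |u s| ≤ 1 :=
    fun f v S hv hc => pair_le_of_tendsto_rearrangement hy hy0 hπ hw hρ
      (fun s hs => if_pos (hne s hs)) hv hc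
  have hmem : gaugeY.Mem u := mem_of hpair
  have hval : ∀ k r, val (e gaugeY (Nat.pair j 0) + mk u hmem) (Nat.pair k r) =
      (if k = j ∧ r = 0 then 1 else 0) + if k = j ∧ r ≠ 0 then w (r - 1) else 0 := fun k r => by
    rw [map_add, Pi.add_apply, val_mk, val_e, Pi.single_apply]
    simp only [hu, Nat.unpair_pair, Nat.pair_eq_pair]
  refine ⟨e gaugeY (Nat.pair j 0) + mk u hmem, ?_, ?_, fun r => ?_, fun k r hk => ?_⟩
  · refine (norm_add_le _ _).trans ?_
    have : ‖mk u hmem‖ ≤ 1 := nrm_le hpair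
    rw [norm_e]
    linarith
  · simp [hval]
  · simp [hval]
  · simp [hval, hk]

/-- No asymptotic model of `Sp gaugeX` is equivalent to the unit vector basis of `ℓ₁`. -/
theorem not_equivToL1Basis_of_isAsymptoticModel {F : Type*} [NormedAddCommGroup F]
    [NormedSpace ℝ F] {v : ℕ → F} (hv : IsAsymptoticModel (Sp gaugeX) v) :
    ¬ EquivToL1Basis v := by
  rintro ⟨A, B, hA, -, hAB⟩
  obtain ⟨-, -, y, ⟨K, hK, -⟩, hy⟩ := hv
  set U := Filter.hyperfilter ℕ
  have hU : (U : Filter ℕ) ≤ atTop := Nat.hyperfilter_le_atTop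
  have hy1 : ∀ j i, ‖y j i‖ ≤ 1 := fun j i => ((hK j).1 i).le
  have hy0 : ∀ j t, Tendsto (fun i => val (y j i) t) U (𝓝 0) := fun j t =>
    (Sp.isReflexive small_gaugeX).tendsto_zero_of_basic hU (hK j).1 (hK j).2 (coord gaugeX t)
  choose π hπ hmax using fun j i => exists_rearrangement (tendsto_val_zero (y j i))
  choose w hw using fun j r => exists_tendsto_of_abs_le U (a := fun i => val (y j i) (π j i r))
    fun i => (abs_val_le_norm _ _).trans (hy1 j i)
  choose p hp2 hp0 hpw hpk using fun j => exists_modelRow (hy1 j) (hy0 j) (hπ j) (hw j) j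
  have hε : 0 < A⁻¹ / 4 := by positivity
  obtain ⟨n, b, hb, hnorm⟩ := (Sp.isReflexive small_gaugeY).exists_norm_sum_le hp2 hε
  set x := ∑ j ∈ Finset.range n, b j • p j with hx
  have hval : ∀ j < n, ∀ r, val x (Nat.pair j r) = b j * val (p j) (Nat.pair j r) :=
    fun j hj r => by
      rw [hx, map_sum, Finset.sum_apply, Finset.sum_eq_single_of_mem j (Finset.mem_range.2 hj)
        fun k _ hk => ?_]
      · rw [map_smul, Pi.smul_apply, smul_eq_mul]
      · rw [map_smul, Pi.smul_apply, hpk k j r hk.symm, smul_zero]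
  have hsq : ∑ k : Fin n, b k ^ 2 ≤ ‖x‖ ^ 2 := by
    have h := sum_sq_le_nrm_sq x.mem ((Finset.range n).image fun j => Nat.pair j 0)
    rw [Finset.sum_image fun j _ k _ h => (Nat.pair_eq_pair.1 h).1] at h
    rw [Fin.sum_univ_eq_sum_range fun k => b k ^ 2]
    refine le_trans (le_of_eq (Finset.sum_congr rfl fun j hj => ?_)) h
    rw [hval j (Finset.mem_range.1 hj), hp0, mul_one]
  have hlim := iteratedLimit_le (N := n) hU x.mem (y := y) (b := b)
    (fun j hj Q η κ s hQ hκ hs => hs.step (hy1 j) (hy0 j) (hπ j) (hmax j) (hw j)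
      (fun r => by rw [hval j hj, hpw]) hQ hκ) n 0 0 0 0 _ (by omega) le_rfl
    (isApproxSplit_zero _) (by simpa only [zero_add] using hy n b)
  simp only [zero_add, mul_zero, add_zero] at hlim
  have h1 := Real.sqrt_le_sqrt hsq
  rw [Real.sqrt_sq (norm_nonneg x)] at h1
  have h2 := (hAB n b).1
  rw [hb, mul_one] at h2
  rw [← norm_def] at hlim
  linarith

/-- Example 3.13: there are reflexive Banach spaces `X` and `Y` so that `Y` (via a basis)
is a spreading model of (a normalized basic sequence in) `X`, `ℓ₁` is a spreading model
of (a normalized basic sequence in) `Y`, and `ℓ₁` is not equivalent to any asymptotic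
model of `X`. -/
theorem stmt_12 :
    ∃ X Y : BanachSpc,
      IsReflexive X.carrier ∧ IsReflexive Y.carrier ∧
      (∃ u : ℕ → Y.carrier, IsSchauderBasis u ∧
        ∃ x : ℕ → X.carrier, Normalized x ∧ (∃ C : ℝ, IsCBasic C x) ∧
          IsSpreadingModelOf x u) ∧
      (∃ v : ℕ → Y.carrier, Normalized v ∧ (∃ C : ℝ, IsCBasic C v) ∧
        ∃ (F : NormedSpc) (e : ℕ → F.carrier), Normalized e ∧ (∃ C : ℝ, IsCBasic C e) ∧
          IsSpreadingModelOf v e ∧ EquivToL1Basis e) ∧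
      (∀ (F : Type) [NormedAddCommGroup F] [NormedSpace ℝ F] (e : ℕ → F),
        IsAsymptoticModel X.carrier e → ¬ EquivToL1Basis e) := by
  refine ⟨⟨Sp gaugeX⟩, ⟨Sp gaugeY⟩, Sp.isReflexive small_gaugeX, Sp.isReflexive small_gaugeY,
    ?_, ?_, fun F _ _ v hv => not_equivToL1Basis_of_isAsymptoticModel hv⟩
  · obtain ⟨x, ⟨hx, hxC⟩, h⟩ := exists_spreadingModel_X
    exact ⟨e gaugeY, isSchauderBasis_e, x, hx, hxC, h⟩
  · obtain ⟨y, ⟨hy, hyC⟩, h⟩ := exists_spreadingModel_Y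
    exact ⟨y, hy, hyC, ⟨Sp gaugeOne⟩, e gaugeOne, norm_e, ⟨1, isCBasic_e⟩, h, equivToL1Basis_e⟩
end

section
/- For 1 < p < ∞, every asymptotic model of ℓ_p is 1-equivalent to the unit vector basis of ℓ_p; that is, if (e_i)_{i∈ω} is an asymptotic model of ℓ_p generated by some basic array, then ‖Σ_{i<n} a_i e_i‖ = (Σ_{i<n} |a_i|^p)^{1/p} for all n and all scalars (a_i)_{i<n}. -/
open Filter Finset Topology

variable {X : Type*} [NormedAddCommGroup X] [NormedSpace ℝ X]
variable {E : Type*} [NormedAddCommGroup E] [NormedSpace ℝ E]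

/-- Bounded real families converge along ultrafilters. -/
theorem exists_tendsto_ultrafilter_of_abs_le {ι : Type*} (U : Ultrafilter ι) {C : ℝ} {f : ι → ℝ}
    (hf : ∀ i, |f i| ≤ C) : ∃ c, Tendsto f U (𝓝 c) := by
  obtain ⟨c, -, hc⟩ := (isCompact_Icc (a := -C) (b := C)).ultrafilter_le_nhds (U.map f) (by
    rw [le_principal_iff]
    exact mem_map.2 (univ_mem' fun i => abs_le.1 (hf i)))
  exact ⟨c, hc⟩

theorem IteratedLimit.unique : ∀ {n : ℕ} {f : (Fin n → ℕ) → ℝ} {L L' : ℝ},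
    IteratedLimit n f L → IteratedLimit n f L' → L = L'
  | 0, _, _, _, h, h' => Eq.trans (Eq.symm h) h'
  | _ + 1, _, _, _, ⟨g, hg, hL⟩, ⟨g', hg', hL'⟩ => by
    have : g = g' := funext fun i => (hg i).unique (hg' i)
    subst this
    exact tendsto_nhds_unique hL hL'

section LpSequence

variable {p : ENNReal} [Fact (1 ≤ p)]

theorem lp_toReal_pos (hp : p ≠ ⊤) : 0 < p.toReal :=
  ENNReal.toReal_pos (zero_lt_one.trans_le Fact.out).ne' hp

theorem lp_norm_sum_single_add_rpow (hp : p ≠ ⊤) (x y : lp (fun _ : ℕ => ℝ) p) (s : Finset ℕ) :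
    ‖(∑ k ∈ s, lp.single p k (x k) : lp (fun _ : ℕ => ℝ) p) + y‖ ^ p.toReal =
      ‖y‖ ^ p.toReal - ∑ k ∈ s, ‖y k‖ ^ p.toReal + ∑ k ∈ s, ‖x k + y k‖ ^ p.toReal := by
  set f : lp (fun _ : ℕ => ℝ) p := (∑ k ∈ s, lp.single p k (x k)) + y with hf
  have hfk : ∀ k ∈ s, f k = x k + y k := by
    intro k hk
    rw [hf, lp.coeFn_add, Pi.add_apply, lp.coeFn_sum, Finset.sum_apply]
    simp only [lp.coeFn_single, Finset.sum_pi_single, if_pos hk]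
  have hcompl : f - ∑ k ∈ s, lp.single p k (f k) = y - ∑ k ∈ s, lp.single p k (y k) := by
    have : ∑ k ∈ s, lp.single (E := fun _ : ℕ => ℝ) p k (f k) =
        ∑ k ∈ s, lp.single p k (x k) + ∑ k ∈ s, lp.single p k (y k) := by
      rw [← Finset.sum_add_distrib]
      refine Finset.sum_congr rfl fun k hk => ?_
      rw [hfk k hk, lp.single_add]
    rw [this, hf]
    abel
  have h1 := lp.norm_sub_norm_compl_sub_single (lp_toReal_pos hp) f s
  have h2 := lp.norm_sub_norm_compl_sub_single (lp_toReal_pos hp) y s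
  rw [hcompl, Finset.sum_congr (g := fun k => ‖x k + y k‖ ^ p.toReal) rfl
    fun k hk => by rw [hfk k hk]] at h1
  linarith

/-- If `y i` tends to `0` coordinatewise and `‖y i‖` tends to `r`, then
`‖x + y i‖ ^ p` tends to `‖x‖ ^ p + r ^ p`. -/
theorem lp_tendsto_norm_add_rpow (hp : p ≠ ⊤) {ι : Type*} {l : Filter ι}
    {y : ι → lp (fun _ : ℕ => ℝ) p} {r : ℝ} (hy : ∀ k, Tendsto (fun i => y i k) l (𝓝 0))
    (hr : Tendsto (fun i => ‖y i‖) l (𝓝 r)) (hr0 : 0 ≤ r) (x : lp (fun _ : ℕ => ℝ) p) :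
    Tendsto (fun i => ‖x + y i‖ ^ p.toReal) l (𝓝 (‖x‖ ^ p.toReal + r ^ p.toReal)) := by
  have hP := lp_toReal_pos (p := p) hp
  have hpow : ∀ c : ℝ, ContinuousAt (fun t : ℝ => t ^ p.toReal) c :=
    fun c => (Real.continuous_rpow_const hP.le).continuousAt
  have hinv : Continuous (fun t : ℝ => t ^ (1 / p.toReal)) :=
    Real.continuous_rpow_const (by positivity)
  have hroot : ∀ t : ℝ, 0 ≤ t → (t ^ p.toReal) ^ (1 / p.toReal) = t := by
    intro t ht
    rw [one_div, Real.rpow_rpow_inv ht hP.ne']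
  have hsum : Tendsto (fun s : Finset ℕ => (∑ k ∈ s, lp.single p k (x k) :
      lp (fun _ : ℕ => ℝ) p)) atTop (𝓝 x) := lp.hasSum_single hp x
  have hfin : ∀ s : Finset ℕ, Tendsto
      (fun i => ‖(∑ k ∈ s, lp.single p k (x k) : lp (fun _ : ℕ => ℝ) p) + y i‖ ^ p.toReal) l
      (𝓝 (‖(∑ k ∈ s, lp.single p k (x k) : lp (fun _ : ℕ => ℝ) p)‖ ^ p.toReal +
        r ^ p.toReal)) := by
    intro s
    simp only [lp_norm_sum_single_add_rpow hp]
    have h1 : Tendsto (fun i => ‖y i‖ ^ p.toReal) l (𝓝 (r ^ p.toReal)) := (hpow r).tendsto.comp hr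
    have h2 : Tendsto (fun i => ∑ k ∈ s, ‖y i k‖ ^ p.toReal) l (𝓝 0) := by
      have : Tendsto (fun i => ∑ k ∈ s, ‖y i k‖ ^ p.toReal) l
          (𝓝 (∑ k ∈ s, ‖(0 : ℝ)‖ ^ p.toReal)) :=
        tendsto_finsetSum s fun k _ => (hpow _).tendsto.comp (hy k).norm
      simpa [Real.zero_rpow hP.ne'] using this
    have h3 : Tendsto (fun i => ∑ k ∈ s, ‖x k + y i k‖ ^ p.toReal) l
        (𝓝 (∑ k ∈ s, ‖x k + 0‖ ^ p.toReal)) :=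
      tendsto_finsetSum s fun k _ => (hpow _).tendsto.comp ((hy k).const_add (x k)).norm
    convert (h1.sub h2).add h3 using 2
    rw [lp.norm_sum_single hP (fun k => x k) s]
    simp only [add_zero, sub_zero]
    ring
  have hunif : TendstoUniformly
      (fun (s : Finset ℕ) i => ‖(∑ k ∈ s, lp.single p k (x k) : lp (fun _ : ℕ => ℝ) p) + y i‖)
      (fun i => ‖x + y i‖) atTop := by
    rw [Metric.tendstoUniformly_iff]
    intro ε hε
    filter_upwards [Metric.tendsto_nhds.1 hsum ε hε] with s hs i
    refine lt_of_le_of_lt ?_ hs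
    rw [Real.dist_eq, dist_comm, dist_eq_norm]
    refine (abs_norm_sub_norm_le _ _).trans_eq ?_
    rw [add_sub_add_right_eq_sub]
  have hlim : Tendsto (fun i => ‖x + y i‖) l
      (𝓝 ((‖x‖ ^ p.toReal + r ^ p.toReal) ^ (1 / p.toReal))) := by
    refine hunif.tendsto_of_eventually_tendsto
      (L := fun s => (‖(∑ k ∈ s, lp.single p k (x k) : lp (fun _ : ℕ => ℝ) p)‖ ^ p.toReal +
        r ^ p.toReal) ^ (1 / p.toReal)) (Eventually.of_forall fun s => ?_) ?_
    · have := (hinv.tendsto _).comp (hfin s)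
      refine this.congr fun i => ?_
      simp only [Function.comp_apply]
      exact hroot _ (norm_nonneg _)
    · exact (hinv.tendsto _).comp (((hpow _).tendsto.comp hsum.norm).add_const _)
  have := (hpow _).tendsto.comp hlim
  rw [one_div, Real.rpow_inv_rpow (by positivity) hP.ne'] at this
  exact this

/-- If `y` tends to `w` coordinatewise along an ultrafilter, then sums of `N` terms of `y`, arbitrarily
far out, approximate `N • w` up to `O(N ^ (1 / p))`. -/
theorem lp_exists_sum_sub_nsmul_rpow_le (hp : p ≠ ⊤) {y : ℕ → lp (fun _ : ℕ => ℝ) p}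
    {U : Ultrafilter ℕ} (hU : (U : Filter ℕ) ≤ atTop) {w : lp (fun _ : ℕ => ℝ) p} {r : ℝ}
    (hw : ∀ k, Tendsto (fun i => y i k) U (𝓝 (w k)))
    (hr : Tendsto (fun i => ‖y i - w‖) U (𝓝 r)) (hr0 : 0 ≤ r) (m N : ℕ) :
    ∃ n, m ≤ n ∧ ∃ a : ℕ → ℝ, ‖∑ i ∈ Finset.Ico m n, a i • y i - (N : ℝ) • w‖ ^ p.toReal ≤
      N * (r ^ p.toReal + 1) := by
  have hP := lp_toReal_pos (p := p) hp
  induction N with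
  | zero => exact ⟨m, le_rfl, 0, by simp [Real.zero_rpow hP.ne']⟩
  | succ N ih =>
    obtain ⟨n, hmn, a, ha⟩ := ih
    set T := ∑ i ∈ Finset.Ico m n, a i • y i with hT
    have hz : ∀ k, Tendsto (fun i => (y i - w) k) U (𝓝 0) := by
      intro k
      simpa [lp.coeFn_sub] using (hw k).sub_const (w k)
    have hlim := lp_tendsto_norm_add_rpow hp hz hr hr0 (T - (N : ℝ) • w)
    have hev := hlim.eventually (gt_mem_nhds (lt_add_one _))
    obtain ⟨i, hi, hni⟩ := (hev.and (hU (eventually_ge_atTop n))).exists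
    refine ⟨i + 1, by omega, fun j => if j < n then a j else if j = i then 1 else 0, ?_⟩
    have hsum : ∑ j ∈ Finset.Ico m (i + 1),
        (if j < n then a j else if j = i then 1 else 0) • y j = T + y i := by
      rw [Finset.sum_Ico_succ_top (by omega), ← Finset.sum_Ico_consecutive _ hmn hni]
      have h1 : ∑ j ∈ Finset.Ico m n, (if j < n then a j else if j = i then 1 else 0) • y j = T :=
        Finset.sum_congr rfl fun j hj => by rw [if_pos (Finset.mem_Ico.1 hj).2]
      have h2 : ∑ j ∈ Finset.Ico n i, (if j < n then a j else if j = i then 1 else 0) • y j = 0 :=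
        Finset.sum_eq_zero fun j hj => by
          have := Finset.mem_Ico.1 hj
          rw [if_neg (by omega), if_neg (by omega), zero_smul]
      rw [h1, h2, if_neg (by omega), if_pos rfl]
      simp
    rw [hsum]
    have hrew : T + y i - ((N + 1 : ℕ) : ℝ) • w = T - (N : ℝ) • w + (y i - w) := by
      push_cast
      rw [add_smul, one_smul]
      abel
    rw [hrew]
    push_cast
    nlinarith

theorem lp_exists_norm_sum_sub_lt (hp1 : 1 < p) (hp : p ≠ ⊤) {y : ℕ → lp (fun _ : ℕ => ℝ) p}
    {U : Ultrafilter ℕ} (hU : (U : Filter ℕ) ≤ atTop) {w : lp (fun _ : ℕ => ℝ) p} {r : ℝ}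
    (hw : ∀ k, Tendsto (fun i => y i k) U (𝓝 (w k)))
    (hr : Tendsto (fun i => ‖y i - w‖) U (𝓝 r)) (hr0 : 0 ≤ r) (m : ℕ) {ε : ℝ} (hε : 0 < ε) :
    ∃ n, m ≤ n ∧ ∃ a : ℕ → ℝ, ‖∑ i ∈ Finset.Ico m n, a i • y i - w‖ < ε := by
  have hP := lp_toReal_pos (p := p) hp
  have hP1 : 1 < p.toReal := by
    simpa using (ENNReal.toReal_lt_toReal ENNReal.one_ne_top hp).2 hp1
  have hlim : Tendsto (fun N : ℕ => (N : ℝ) ^ (-(p.toReal - 1)) * (r ^ p.toReal + 1)) atTop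
      (𝓝 0) := by
    simpa using ((tendsto_rpow_neg_atTop (sub_pos.2 hP1)).comp
      tendsto_natCast_atTop_atTop).mul_const (r ^ p.toReal + 1)
  obtain ⟨N, hN, hN0⟩ := ((hlim.eventually (gt_mem_nhds (Real.rpow_pos_of_pos hε p.toReal))).and
    (eventually_gt_atTop 0)).exists
  have hN0' : (0 : ℝ) < N := by exact_mod_cast hN0
  obtain ⟨n, hmn, a, ha⟩ := lp_exists_sum_sub_nsmul_rpow_le hp hU hw hr hr0 m N
  refine ⟨n, hmn, fun i => (N : ℝ)⁻¹ * a i, ?_⟩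
  have hrew : ∑ i ∈ Finset.Ico m n, ((N : ℝ)⁻¹ * a i) • y i - w =
      (N : ℝ)⁻¹ • (∑ i ∈ Finset.Ico m n, a i • y i - (N : ℝ) • w) := by
    rw [smul_sub, smul_smul, inv_mul_cancel₀ hN0'.ne', one_smul, Finset.smul_sum]
    simp only [smul_smul]
  rw [← Real.rpow_lt_rpow_iff (norm_nonneg _) hε.le hP, hrew, norm_smul,
    Real.mul_rpow (norm_nonneg _) (norm_nonneg _), Real.norm_of_nonneg (by positivity),
    Real.inv_rpow hN0'.le]
  refine lt_of_le_of_lt ?_ hN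
  calc ((N : ℝ) ^ p.toReal)⁻¹ * ‖∑ i ∈ Finset.Ico m n, a i • y i - (N : ℝ) • w‖ ^ p.toReal
      ≤ ((N : ℝ) ^ p.toReal)⁻¹ * (N * (r ^ p.toReal + 1)) := by gcongr
    _ = (N : ℝ) ^ (-(p.toReal - 1)) * (r ^ p.toReal + 1) := by
      rw [← mul_assoc, neg_sub, Real.rpow_sub hN0', Real.rpow_one]
      ring

/-- If `w` is approximated by linear combinations of `y` starting arbitrarily far out, and `y` is
basic, then `w = 0`. -/
theorem IsCBasic.eq_zero_of_approx {K : ℝ} {y : ℕ → X} (hy : IsCBasic K y) {w : X}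
    (h : ∀ (m : ℕ) (ε : ℝ), 0 < ε →
      ∃ n, m ≤ n ∧ ∃ a : ℕ → ℝ, ‖∑ i ∈ Finset.Ico m n, a i • y i - w‖ < ε) : w = 0 := by
  rw [← norm_le_zero_iff]
  refine le_of_forall_pos_le_add fun δ hδ => ?_
  obtain ⟨ε, hε, hεδ⟩ : ∃ ε : ℝ, 0 < ε ∧ ε * (2 * |K| + 1) = δ :=
    ⟨δ / (2 * |K| + 1), by positivity, by field_simp⟩
  obtain ⟨n, -, a, ha⟩ := h 0 ε hε
  obtain ⟨n', hnn', b, hb⟩ := h n ε hε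
  rw [← Finset.range_eq_Ico] at ha
  set T := ∑ i ∈ Finset.range n, a i • y i with hT
  set S := ∑ i ∈ Finset.Ico n n', b i • y i with hS
  have key := hy.2 n (n' + 1) (by omega) fun i => if i < n then a i else if i < n' then -b i else 0
  have h1 : ∑ i ∈ Finset.range n, (if i < n then a i else if i < n' then -b i else 0) • y i = T :=
    Finset.sum_congr rfl fun i hi => by rw [if_pos (Finset.mem_range.1 hi)]
  have h2 : ∑ i ∈ Finset.range (n' + 1),
      (if i < n then a i else if i < n' then -b i else 0) • y i = T - S := by
    rw [Finset.sum_range_succ, ← Finset.sum_range_add_sum_Ico _ hnn', h1, if_neg (by omega),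
      if_neg (by omega), zero_smul, add_zero, sub_eq_add_neg, hS, ← Finset.sum_neg_distrib]
    congr 1
    refine Finset.sum_congr rfl fun i hi => ?_
    have := Finset.mem_Ico.1 hi
    rw [if_neg (by omega), if_pos (by omega), neg_smul]
  rw [h1, h2] at key
  have hTS : ‖T - S‖ ≤ 2 * ε := by
    have : T - S = (T - w) - (S - w) := by abel
    rw [this]
    linarith [norm_sub_le (T - w) (S - w)]
  have hwT : ‖w‖ ≤ ‖T‖ + ‖T - w‖ := by
    have : w = T - (T - w) := by abel
    conv_lhs => rw [this]
    exact norm_sub_le _ _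
  have hK : K * ‖T - S‖ ≤ |K| * (2 * ε) :=
    mul_le_mul (le_abs_self K) hTS (norm_nonneg _) (abs_nonneg _)
  linarith

/-- For `1 < p < ∞`, normalized basic sequences in `ℓ_p` are coordinatewise null. -/
theorem lp_tendsto_apply_zero_of_isCBasic (hp1 : 1 < p) (hp : p ≠ ⊤) {K : ℝ}
    {y : ℕ → lp (fun _ : ℕ => ℝ) p} (hn : Normalized y) (hy : IsCBasic K y) (k : ℕ) :
    Tendsto (fun i => y i k) atTop (𝓝 0) := by
  rw [tendsto_iff_ultrafilter]
  intro U hU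
  have hcoord : ∀ k, ∃ c, Tendsto (fun i => y i k) U (𝓝 c) := fun k =>
    exists_tendsto_ultrafilter_of_abs_le U (C := 1) fun i =>
      (lp.norm_apply_le_norm (zero_lt_one.trans hp1).ne' (y i) k).trans_eq (hn i)
  choose c hc using hcoord
  have hmem : Memℓp (E := fun _ : ℕ => ℝ) c p := by
    refine lp.memℓp_of_tendsto (l := (U : Filter ℕ)) (F := y) ?_ (tendsto_pi_nhds.2 hc)
    refine isBounded_iff_forall_norm_le.2 ⟨1, ?_⟩
    rintro _ ⟨i, rfl⟩
    exact (hn i).le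
  let w : lp (fun _ : ℕ => ℝ) p := ⟨c, hmem⟩
  obtain ⟨r, hr⟩ := exists_tendsto_ultrafilter_of_abs_le U (C := 1 + ‖w‖)
    (f := fun i => ‖y i - w‖) fun i => by
      rw [abs_norm]
      exact (norm_sub_le _ _).trans_eq (by rw [hn i])
  have hr0 : 0 ≤ r := ge_of_tendsto' hr fun i => norm_nonneg _
  have hw0 : w = 0 := hy.eq_zero_of_approx fun m ε hε =>
    lp_exists_norm_sum_sub_lt hp1 hp hU (w := w) hc hr hr0 m hε
  have hck : c k = 0 := congrFun (congrArg (fun v : lp (fun _ : ℕ => ℝ) p => (v : ℕ → ℝ)) hw0) k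
  exact hck ▸ hc k

theorem lp_iteratedLimit_norm_add (hp : p ≠ ⊤) (n : ℕ) (b : ℕ → ℝ)
    (y : ℕ → ℕ → lp (fun _ : ℕ => ℝ) p) (hn : ∀ j, Normalized (y j))
    (hy : ∀ j k, Tendsto (fun i => y j i k) atTop (𝓝 0)) (x : lp (fun _ : ℕ => ℝ) p) :
    IteratedLimit n (fun t => ‖x + ∑ j : Fin n, b (j : ℕ) • y (j : ℕ) (t j)‖)
      ((‖x‖ ^ p.toReal + ∑ j ∈ Finset.range n, |b j| ^ p.toReal) ^ (1 / p.toReal)) := by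
  have hP := lp_toReal_pos (p := p) hp
  induction n generalizing b y x with
  | zero => simp [IteratedLimit, Real.rpow_rpow_inv (norm_nonneg x) hP.ne']
  | succ n ih =>
    refine ⟨fun i => (‖x + b 0 • y 0 i‖ ^ p.toReal +
      ∑ j ∈ Finset.range n, |b (j + 1)| ^ p.toReal) ^ (1 / p.toReal), fun i => ?_, ?_⟩
    · have := ih (fun j => b (j + 1)) (fun j => y (j + 1)) (fun j => hn _) (fun j => hy _)
        (x + b 0 • y 0 i)
      simpa [Fin.sum_univ_succ, add_assoc] using this
    · have h0 : ∀ k, Tendsto (fun i => (b 0 • y 0 i) k) atTop (𝓝 0) := fun k => by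
        simpa [lp.coeFn_smul] using (hy 0 k).const_mul (b 0)
      have hnorm : Tendsto (fun i => ‖b 0 • y 0 i‖) atTop (𝓝 |b 0|) := by
        simp [norm_smul, hn 0 _]
      have hlim := lp_tendsto_norm_add_rpow hp h0 hnorm (abs_nonneg _) x
      rw [Finset.sum_range_succ', add_comm (∑ j ∈ Finset.range n, |b (j + 1)| ^ p.toReal),
        ← add_assoc]
      exact ((Real.continuous_rpow_const (by positivity)).tendsto _).comp (hlim.add_const _)

end LpSequence

/-- Remark 3.9: for `1 < p < ∞`, every asymptotic model of `ℓ_p` is 1-equivalent to the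
unit vector basis of `ℓ_p`. -/
theorem stmt_13 (p : ENNReal) [Fact (1 ≤ p)] (hp1 : 1 < p) (hp2 : p ≠ ⊤)
    {E : Type*} [NormedAddCommGroup E] [NormedSpace ℝ E]
    (e : ℕ → E) (h : IsAsymptoticModel (lp (fun _ : ℕ => ℝ) p) e) :
    ∀ (n : ℕ) (a : ℕ → ℝ),
      ‖∑ i ∈ Finset.range n, a i • e i‖ =
        (∑ i ∈ Finset.range n, |a i| ^ p.toReal) ^ (1 / p.toReal) := by
  obtain ⟨-, -, y, ⟨K, hK, -⟩, hgen⟩ := h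
  intro n a
  have hlim := lp_iteratedLimit_norm_add hp2 n a y (fun j => (hK j).1)
    (fun j => lp_tendsto_apply_zero_of_isCBasic hp1 hp2 (hK j).1 (hK j).2) 0
  simp only [zero_add, norm_zero, Real.zero_rpow (lp_toReal_pos hp2).ne'] at hlim
  exact (hgen n a).unique hlim
end
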